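/- arXiv:2201.05084 — 7 statements merged into one kernel-verified Lean document; each statement's English description precedes it below -/
import Mathlib

section
/- For 0 < x < 1, let C(s) and S(s) denote the analytic continuations (in the complex variable s) of the Dirichlet series C(s) = ∑_{n=1}^∞ cos(2πnx) n^{-s} and S(s) = ∑_{n=1}^∞ sin(2πnx) n^{-s}, which converge for Re(s) > 1 and extend holomorphically to a neighbourhood of s = 0. Then the first generalized Stieltjes constant satisfies γ₁(x) = C''(0) − 2(γ + log(2π)) C'(0) + ((γ + log(2π))² − π²/12) C(0) + π S'(0) − π (γ + log(2π)) S(0). -/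
open Real Complex Filter Topology HurwitzZeta

/-- Leibniz rule for the second derivative. -/
lemma iteratedDeriv_two_mul {f g : ℂ → ℂ} {z : ℂ} (hf : AnalyticAt ℂ f z)
    (hg : AnalyticAt ℂ g z) :
    iteratedDeriv 2 (fun s ↦ f s * g s) z =
      iteratedDeriv 2 f z * g z + 2 * deriv f z * deriv g z + f z * iteratedDeriv 2 g z := by
  rw [show (fun s ↦ f s * g s) = f * g from rfl,
    iteratedDeriv_mul hf.contDiffAt hg.contDiffAt]
  simp [Finset.sum_range_succ, iteratedDeriv_one]
  ring

/-- Leibniz rule for the third derivative. -/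
lemma iteratedDeriv_three_mul {f g : ℂ → ℂ} {z : ℂ} (hf : AnalyticAt ℂ f z)
    (hg : AnalyticAt ℂ g z) :
    iteratedDeriv 3 (fun s ↦ f s * g s) z =
      iteratedDeriv 3 f z * g z + 3 * iteratedDeriv 2 f z * deriv g z
        + 3 * deriv f z * iteratedDeriv 2 g z + f z * iteratedDeriv 3 g z := by
  rw [show (fun s ↦ f s * g s) = f * g from rfl,
    iteratedDeriv_mul hf.contDiffAt hg.contDiffAt]
  simp [Finset.sum_range_succ, iteratedDeriv_one]
  ring

lemma analyticAt_Gamma_one : AnalyticAt ℂ Complex.Gamma 1 := by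
  rw [Complex.analyticAt_iff_eventually_differentiableAt]
  filter_upwards [(isOpen_lt continuous_const Complex.continuous_re).mem_nhds
    (show (0 : ℝ) < (1 : ℂ).re by simp)] with s hs
  refine Complex.differentiableAt_Gamma s fun m h ↦ ?_
  have hs' : (0 : ℝ) < s.re := hs
  rw [h, Complex.neg_re, Complex.natCast_re] at hs'
  linarith [m.cast_nonneg (α := ℝ)]

lemma analyticAt_Gamma_one_add : AnalyticAt ℂ (fun s ↦ Complex.Gamma (1 + s)) 0 :=
  AnalyticAt.fun_comp (by simpa using analyticAt_Gamma_one) (by fun_prop)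

lemma analyticAt_Gamma_one_sub : AnalyticAt ℂ (fun s ↦ Complex.Gamma (1 - s)) 0 :=
  AnalyticAt.fun_comp (by simpa using analyticAt_Gamma_one) (by fun_prop)

/-- The reflection formula for the Gamma function, free of denominators. -/
lemma Gamma_one_add_mul_Gamma_one_sub_mul_sin :
    (fun s : ℂ ↦ Complex.Gamma (1 + s) * Complex.Gamma (1 - s) * Complex.sin (π * s))
      =ᶠ[𝓝 0] fun s ↦ (π : ℂ) * s := by
  filter_upwards [Metric.ball_mem_nhds (0 : ℂ) one_pos] with s hs
  rcases eq_or_ne s 0 with rfl | h0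
  · simp
  have hsin : Complex.sin (π * s) ≠ 0 := by
    rw [Complex.sin_ne_zero_iff]
    intro k hk
    rw [mul_comm] at hk
    have hk' : s = k := mul_right_cancel₀ (Complex.ofReal_ne_zero.mpr Real.pi_ne_zero) hk
    rw [hk', mem_ball_zero_iff, Complex.norm_intCast] at hs
    have : k = 0 := Int.abs_lt_one_iff.mp (by exact_mod_cast hs)
    exact h0 (by simp [hk', this])
  rw [add_comm, Complex.Gamma_add_one s h0, mul_assoc s, Complex.Gamma_mul_Gamma_one_sub,
    mul_assoc, div_mul_cancel₀ _ hsin, mul_comm]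

lemma deriv_sin_const_mul_zero (c : ℂ) : deriv (fun s ↦ Complex.sin (c * s)) 0 = c := by
  have := congrFun (iteratedDeriv_comp_const_mul (n := 1) Complex.contDiff_sin c) 0
  simpa [iteratedDeriv_succ] using this

lemma iteratedDeriv_two_sin_const_mul_zero (c : ℂ) :
    iteratedDeriv 2 (fun s ↦ Complex.sin (c * s)) 0 = 0 := by
  rw [iteratedDeriv_comp_const_mul Complex.contDiff_sin]
  simp [iteratedDeriv_succ]

lemma iteratedDeriv_three_sin_const_mul_zero (c : ℂ) :
    iteratedDeriv 3 (fun s ↦ Complex.sin (c * s)) 0 = -c ^ 3 := by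
  rw [iteratedDeriv_comp_const_mul Complex.contDiff_sin]
  simp [iteratedDeriv_succ]

lemma deriv_cos_const_mul_zero (c : ℂ) : deriv (fun s ↦ Complex.cos (c * s)) 0 = 0 := by
  have := congrFun (iteratedDeriv_comp_const_mul (n := 1) Complex.contDiff_cos c) 0
  simpa [iteratedDeriv_succ] using this

lemma iteratedDeriv_two_cos_const_mul_zero (c : ℂ) :
    iteratedDeriv 2 (fun s ↦ Complex.cos (c * s)) 0 = -c ^ 2 := by
  rw [iteratedDeriv_comp_const_mul Complex.contDiff_cos]
  simp [iteratedDeriv_succ]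

/-- The second derivative of the Gamma function at `1` is `γ² + π² / 6`. -/
lemma iteratedDeriv_two_Gamma_one :
    iteratedDeriv 2 Complex.Gamma 1 = (Real.eulerMascheroniConstant : ℂ) ^ 2 + π ^ 2 / 6 := by
  have hpi : (π : ℂ) ≠ 0 := Complex.ofReal_ne_zero.mpr Real.pi_ne_zero
  have hsin : AnalyticAt ℂ (fun s ↦ Complex.sin (π * s)) 0 := by fun_prop
  have h := Gamma_one_add_mul_Gamma_one_sub_mul_sin.iteratedDeriv_eq 3
  rw [iteratedDeriv_three_mul (analyticAt_Gamma_one_add.fun_mul analyticAt_Gamma_one_sub) hsin,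
    iteratedDeriv_two_mul analyticAt_Gamma_one_add analyticAt_Gamma_one_sub,
    deriv_sin_const_mul_zero, iteratedDeriv_two_sin_const_mul_zero,
    iteratedDeriv_three_sin_const_mul_zero, iteratedDeriv_comp_const_add,
    iteratedDeriv_comp_const_sub, deriv_comp_const_add, deriv_comp_const_sub] at h
  have h3 : iteratedDeriv 3 (fun s : ℂ ↦ (π : ℂ) * s) 0 = 0 := by
    simp [iteratedDeriv_succ]
  rw [h3] at h
  simp only [add_zero, sub_zero, Complex.Gamma_one, Complex.hasDerivAt_Gamma_one.deriv,
    mul_zero, Complex.sin_zero, smul_eq_mul] at h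
  have h' : (π : ℂ) * (6 * iteratedDeriv 2 Complex.Gamma 1
      - 6 * (Real.eulerMascheroniConstant : ℂ) ^ 2 - π ^ 2) = 0 := by
    linear_combination h
  linear_combination (1 / 6 : ℂ) * (mul_eq_zero.mp h').resolve_left hpi

lemma hasDerivAt_cpow_neg {c : ℂ} (hc : c ≠ 0) (s : ℂ) :
    HasDerivAt (fun s : ℂ ↦ c ^ (-s)) (-Complex.log c * c ^ (-s)) s := by
  convert (hasDerivAt_neg s).const_cpow (Or.inl hc) using 1
  ring

lemma deriv_cpow_neg_zero {c : ℂ} (hc : c ≠ 0) :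
    deriv (fun s : ℂ ↦ c ^ (-s)) 0 = -Complex.log c := by
  simp [(hasDerivAt_cpow_neg hc 0).deriv]

lemma iteratedDeriv_two_cpow_neg_zero {c : ℂ} (hc : c ≠ 0) :
    iteratedDeriv 2 (fun s : ℂ ↦ c ^ (-s)) 0 = Complex.log c ^ 2 := by
  rw [iteratedDeriv_succ, iteratedDeriv_one, funext fun s ↦ (hasDerivAt_cpow_neg hc s).deriv,
    ((hasDerivAt_cpow_neg hc 0).const_mul _).deriv]
  simp [sq]

/-- The functional equation of the Hurwitz zeta function at `1 - s`, multiplied by `-s` so that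
it also holds at `s = 0`. -/
lemma update_sub_one_mul_hurwitzZeta_one_sub {a : UnitAddCircle} (ha : a ≠ 0) :
    (fun s : ℂ ↦ Function.update (fun w : ℂ ↦ (w - 1) * hurwitzZeta a w) 1 1 (1 - s))
      =ᶠ[𝓝 0] fun s ↦ -2 * (((2 * π : ℂ) ^ (-s) * Complex.Gamma (1 + s)) *
        (Complex.cos (π / 2 * s) * cosZeta a s + Complex.sin (π / 2 * s) * sinZeta a s)) := by
  filter_upwards [Metric.ball_mem_nhds (0 : ℂ) one_pos] with s hs
  rcases eq_or_ne s 0 with rfl | h0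
  · norm_num [cosZeta_apply_zero]
  have hn (n : ℕ) : s ≠ -n := by
    rintro rfl
    rw [mem_ball_zero_iff, norm_neg, Complex.norm_natCast] at hs
    exact h0 (by simp [Nat.lt_one_iff.mp (by exact_mod_cast hs : n < 1)])
  rw [Function.update_of_ne (by simpa using h0), hurwitzZeta,
    hurwitzZetaEven_one_sub a hn (.inl ha), hurwitzZetaOdd_one_sub a hn,
    add_comm 1 s, Complex.Gamma_add_one s h0, mul_div_right_comm]
  ring

/-- A holomorphic continuation of `f` from the half-plane `1 < re s` to a connected open set
agrees with an entire continuation of `f`. -/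
lemma eqOn_of_eq_on_one_lt_re {f g : ℂ → ℂ} {U : Set ℂ} (hUo : IsOpen U)
    (hUc : IsPreconnected U) (hU1 : {s : ℂ | 1 < s.re} ⊆ U) (hf : DifferentiableOn ℂ f U)
    (hg : Differentiable ℂ g) (h : ∀ s : ℂ, 1 < s.re → f s = g s) : Set.EqOn f g U := by
  have h2 : (2 : ℂ) ∈ {s : ℂ | 1 < s.re} := by simp
  refine (hf.analyticOnNhd hUo).eqOn_of_preconnected_of_eventuallyEq
    (hg.differentiableOn.analyticOnNhd hUo) hUc (hU1 h2) ?_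
  filter_upwards [(isOpen_lt continuous_const Complex.continuous_re).mem_nhds h2] with s hs
  exact h s hs

lemma tsum_cos_eq_cosZeta (x : ℝ) {s : ℂ} (hs : 1 < s.re) :
    ∑' n : ℕ, ((Real.cos (2 * π * (n + 1) * x) : ℂ) / ((n : ℂ) + 1) ^ s) =
      cosZeta (x : UnitAddCircle) s := by
  have hs0 : s ≠ 0 := Complex.ne_zero_of_one_lt_re hs
  have h := hasSum_nat_cosZeta x hs
  rw [← h.tsum_eq, h.summable.tsum_eq_zero_add]
  simp [Complex.zero_cpow hs0, mul_right_comm _ (x : ℂ)]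

lemma tsum_sin_eq_sinZeta (x : ℝ) {s : ℂ} (hs : 1 < s.re) :
    ∑' n : ℕ, ((Real.sin (2 * π * (n + 1) * x) : ℂ) / ((n : ℂ) + 1) ^ s) =
      sinZeta (x : UnitAddCircle) s := by
  have h := hasSum_nat_sinZeta x hs
  rw [← h.tsum_eq, h.summable.tsum_eq_zero_add]
  simp [mul_right_comm _ (x : ℂ)]

/-- The second derivative at `s = 1` of `(s - 1) ζ(s, a)` in terms of the derivatives of the
periodic zeta functions at `s = 0`. -/
lemma iteratedDeriv_two_update_sub_one_mul_hurwitzZeta {a : UnitAddCircle} (ha : a ≠ 0) :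
    -(1 / 2 : ℂ) * iteratedDeriv 2
        (Function.update (fun s : ℂ ↦ (s - 1) * hurwitzZeta a s) 1 1) 1
      = iteratedDeriv 2 (cosZeta a) 0
        - 2 * ((Real.eulerMascheroniConstant + Real.log (2 * π) : ℝ) : ℂ) * deriv (cosZeta a) 0
        + (((Real.eulerMascheroniConstant + Real.log (2 * π)) ^ 2 - π ^ 2 / 12 : ℝ) : ℂ)
            * cosZeta a 0
        + (π : ℂ) * deriv (sinZeta a) 0
        - (π : ℂ) * ((Real.eulerMascheroniConstant + Real.log (2 * π) : ℝ) : ℂ)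
            * sinZeta a 0 := by
  have h2pi : (2 * π : ℂ) ≠ 0 := by simp [Real.pi_ne_zero]
  have hlog : Complex.log (2 * π) = (Real.log (2 * π) : ℝ) := by
    rw [Complex.ofReal_log (by positivity)]
    push_cast
    rfl
  have hC : AnalyticAt ℂ (cosZeta a) 0 := (differentiable_cosZeta_of_ne_zero ha).analyticAt 0
  have hS : AnalyticAt ℂ (sinZeta a) 0 := (differentiableAt_sinZeta a).analyticAt 0
  have hcos : AnalyticAt ℂ (fun s ↦ Complex.cos (π / 2 * s)) 0 := by fun_prop
  have hsin : AnalyticAt ℂ (fun s ↦ Complex.sin (π / 2 * s)) 0 := by fun_prop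
  have hpow : AnalyticAt ℂ (fun s : ℂ ↦ (2 * π : ℂ) ^ (-s)) 0 :=
    Differentiable.analyticAt (fun s ↦ (hasDerivAt_cpow_neg h2pi s).differentiableAt) 0
  have hCcos := hcos.fun_mul hC
  have hSsin := hsin.fun_mul hS
  have h := (update_sub_one_mul_hurwitzZeta_one_sub ha).iteratedDeriv_eq 2
  rw [iteratedDeriv_comp_const_sub, iteratedDeriv_const_mul_field,
    iteratedDeriv_two_mul (hpow.fun_mul analyticAt_Gamma_one_add) (hCcos.fun_add hSsin),
    iteratedDeriv_two_mul hpow analyticAt_Gamma_one_add,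
    iteratedDeriv_fun_add hCcos.contDiffAt hSsin.contDiffAt,
    iteratedDeriv_two_mul hcos hC, iteratedDeriv_two_mul hsin hS,
    deriv_fun_add hCcos.differentiableAt hSsin.differentiableAt,
    deriv_fun_mul hcos.differentiableAt hC.differentiableAt,
    deriv_fun_mul hsin.differentiableAt hS.differentiableAt,
    deriv_fun_mul hpow.differentiableAt analyticAt_Gamma_one_add.differentiableAt,
    deriv_cpow_neg_zero h2pi, iteratedDeriv_two_cpow_neg_zero h2pi,
    deriv_sin_const_mul_zero, iteratedDeriv_two_sin_const_mul_zero,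
    deriv_cos_const_mul_zero, iteratedDeriv_two_cos_const_mul_zero,
    iteratedDeriv_comp_const_add, deriv_comp_const_add, hlog] at h
  simp only [add_zero, sub_zero, Complex.Gamma_one, Complex.hasDerivAt_Gamma_one.deriv,
    iteratedDeriv_two_Gamma_one, mul_zero, neg_zero, Complex.cpow_zero, Complex.sin_zero,
    Complex.cos_zero, smul_eq_mul] at h
  simp only [Complex.ofReal_add, Complex.ofReal_sub, Complex.ofReal_pow, Complex.ofReal_div,
    Complex.ofReal_ofNat]
  linear_combination -(1 / 2 : ℂ) * h

/-- For `0 < x < 1`, let `C` and `S` be the analytic continuations of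
the Dirichlet series `∑ₙ cos(2πnx) n⁻ˢ` and `∑ₙ sin(2πnx) n⁻ˢ` (holomorphic on open
connected sets `U`, `V` containing the half-plane `Re s > 1` and the point `s = 0`, and
agreeing with the series for `Re s > 1`).  Then the first generalized Stieltjes constant
`γ₁(x) = -(1/2) · d²/ds²[(s-1)ζ(s,x)]` at `s = 1` (the removable singularity of
`(s-1)ζ(s,x)` at `s = 1` being filled in with the residue `1`) satisfies
`γ₁(x) = C''(0) - 2(γ + log 2π) C'(0) + ((γ + log 2π)² - π²/12) C(0)
          + π S'(0) - π (γ + log 2π) S(0)`. -/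
theorem stieltjes_gamma1_eq_deriv_cos_sin_series
    (x : ℝ) (hx0 : 0 < x) (hx1 : x < 1)
    (C S : ℂ → ℂ) (U V : Set ℂ)
    (hUo : IsOpen U) (hUc : IsPreconnected U)
    (hU1 : {s : ℂ | 1 < s.re} ⊆ U) (hU0 : (0 : ℂ) ∈ U)
    (hVo : IsOpen V) (hVc : IsPreconnected V)
    (hV1 : {s : ℂ | 1 < s.re} ⊆ V) (hV0 : (0 : ℂ) ∈ V)
    (hCd : DifferentiableOn ℂ C U)
    (hSd : DifferentiableOn ℂ S V)
    (hCs : ∀ s : ℂ, 1 < s.re →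
      C s = ∑' n : ℕ, ((Real.cos (2 * π * (n + 1) * x) : ℂ) / ((n : ℂ) + 1) ^ s))
    (hSs : ∀ s : ℂ, 1 < s.re →
      S s = ∑' n : ℕ, ((Real.sin (2 * π * (n + 1) * x) : ℂ) / ((n : ℂ) + 1) ^ s)) :
    -(1 / 2 : ℂ) * iteratedDeriv 2
        (Function.update (fun s : ℂ => (s - 1) * hurwitzZeta (x : UnitAddCircle) s) 1 1) 1
      = iteratedDeriv 2 C 0
        - 2 * ((Real.eulerMascheroniConstant + Real.log (2 * π) : ℝ) : ℂ) * deriv C 0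
        + (((Real.eulerMascheroniConstant + Real.log (2 * π)) ^ 2 - π ^ 2 / 12 : ℝ) : ℂ)
            * C 0
        + (π : ℂ) * deriv S 0
        - (π : ℂ) * ((Real.eulerMascheroniConstant + Real.log (2 * π) : ℝ) : ℂ) * S 0 := by
  have ha : (x : UnitAddCircle) ≠ 0 := by
    rw [Ne, AddCircle.coe_eq_zero_iff_of_mem_Ico (p := (1 : ℝ)) ⟨hx0.le, by simpa using hx1⟩]
    exact hx0.ne'
  have hC : C =ᶠ[𝓝 0] cosZeta x :=
    (eqOn_of_eq_on_one_lt_re hUo hUc hU1 hCd (differentiable_cosZeta_of_ne_zero ha)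
      fun s hs ↦ (hCs s hs).trans (tsum_cos_eq_cosZeta x hs)).eventuallyEq_of_mem
        (hUo.mem_nhds hU0)
  have hS : S =ᶠ[𝓝 0] sinZeta x :=
    (eqOn_of_eq_on_one_lt_re hVo hVc hV1 hSd (differentiableAt_sinZeta x)
      fun s hs ↦ (hSs s hs).trans (tsum_sin_eq_sinZeta x hs)).eventuallyEq_of_mem
        (hVo.mem_nhds hV0)
  rw [hC.iteratedDeriv_eq, hC.deriv_eq, hC.eq_of_nhds, hS.deriv_eq, hS.eq_of_nhds]
  exact iteratedDeriv_two_update_sub_one_mul_hurwitzZeta ha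
end

section
/- For 0 < x < 1/2, the first generalized Stieltjes constant satisfies the functional equation γ₁(1/2 − x) − γ₁(x + 1/2) = −2[γ₁(2x) − γ₁(1 − 2x)] + [γ₁(x) − γ₁(1 − x)] + 2π log 2 · cot(2πx). -/
open Real Complex Filter Topology HurwitzZeta

/-- The first generalized Stieltjes constant `γ₁(x)` for `0 < x ≤ 1`, defined as
`-(1/2) · d²/ds²[(s-1)ζ(s,x)]` evaluated at `s = 1`, where `ζ(s,x)` is the Hurwitz zeta
function and the removable singularity of `(s-1)ζ(s,x)` at `s = 1` is filled in with its
limiting value `1` (the residue of `ζ(s,x)` at `s = 1`). -/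
noncomputable def stieltjesGamma1 (x : ℝ) : ℂ :=
  -(1 / 2 : ℂ) * iteratedDeriv 2
    (Function.update (fun s : ℂ => (s - 1) * hurwitzZeta (x : UnitAddCircle) s) 1 1) 1

/-- `(s - 1) ζ(s, a)` with its removable singularity at `s = 1` filled in is entire. -/
lemma differentiable_update_sub_one_mul_hurwitzZeta (a : UnitAddCircle) :
    Differentiable ℂ (Function.update (fun s : ℂ => (s - 1) * hurwitzZeta a s) 1 1) := by
  rw [← differentiableOn_univ, ← differentiableOn_compl_singleton_and_continuousAt_iff
    (univ_mem : _ ∈ 𝓝 (1 : ℂ)), ← Set.compl_eq_univ_sdiff]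
  constructor
  · refine DifferentiableOn.congr (f := fun s => (s - 1) * hurwitzZeta a s) ?_ ?_
    · intro s hs
      have := differentiableAt_hurwitzZeta a (s := s) (by simpa using hs)
      exact (DifferentiableAt.mul (by fun_prop) this).differentiableWithinAt
    · intro s hs
      rw [Function.update_of_ne (by simpa using hs)]
  · rw [continuousAt_update_same]
    exact hurwitzZeta_residue_one a

/-- The antisymmetrized first Stieltjes constant is a derivative of the odd Hurwitz zeta
function at `s = 1`. -/
lemma stieltjesGamma1_sub_of_coe_eq_neg {a b : ℝ} (h : (b : UnitAddCircle) = -a) :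
    stieltjesGamma1 a - stieltjesGamma1 b = -2 * deriv (hurwitzZetaOdd a) 1 := by
  have hO := differentiable_hurwitzZetaOdd (a : UnitAddCircle)
  have key : Function.update (fun s : ℂ => (s - 1) * hurwitzZeta (a : UnitAddCircle) s) 1 1
      - Function.update (fun s : ℂ => (s - 1) * hurwitzZeta (b : UnitAddCircle) s) 1 1
      = fun s => (s - 1) * (2 * hurwitzZetaOdd a s) := by
    funext s
    by_cases hs : s = 1
    · simp [hs]
    · simp only [Pi.sub_apply, Function.update_of_ne hs, hurwitzZetaOdd_eq, h]
      ring
  have hd : deriv (fun s : ℂ => (s - 1) * (2 * hurwitzZetaOdd a s))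
      = fun s => 2 * hurwitzZetaOdd a s + (s - 1) * (2 * deriv (hurwitzZetaOdd a) s) := by
    funext s
    refine (((hasDerivAt_id s).sub_const 1).mul ((hO s).hasDerivAt.const_mul 2)).deriv.trans ?_
    simp
  have hO' : Differentiable ℂ (deriv (hurwitzZetaOdd a)) :=
    (hO.contDiff (n := 2)).differentiable_deriv_two
  have h2 : iteratedDeriv 2 (fun s : ℂ => (s - 1) * (2 * hurwitzZetaOdd a s)) 1
      = 4 * deriv (hurwitzZetaOdd a) 1 := by
    rw [iteratedDeriv_succ, iteratedDeriv_one, hd]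
    have := (((hO 1).hasDerivAt.const_mul 2).add
      (((hasDerivAt_id (1 : ℂ)).sub_const 1).mul ((hO' 1).hasDerivAt.const_mul 2))).deriv
    simp only [id] at this
    refine Eq.trans this ?_
    ring
  rw [← key, iteratedDeriv_sub
    (differentiable_update_sub_one_mul_hurwitzZeta _).contDiff.contDiffAt
    (differentiable_update_sub_one_mul_hurwitzZeta _).contDiff.contDiffAt] at h2
  simp only [stieltjesGamma1]
  linear_combination (-1 / 2 : ℂ) * h2

/-- Duplication formula for the Hurwitz zeta function in the region of convergence. -/
lemma hurwitzZeta_add_hurwitzZeta_add_half {a : ℝ} (ha : a ∈ Set.Icc 0 (1 / 2)) {s : ℂ}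
    (hs : 1 < s.re) :
    hurwitzZeta (a : UnitAddCircle) s + hurwitzZeta ((a + 1 / 2 : ℝ) : UnitAddCircle) s
      = 2 ^ s * hurwitzZeta ((2 * a : ℝ) : UnitAddCircle) s := by
  obtain ⟨h0, h1⟩ := ha
  have hA := hasSum_hurwitzZeta_of_one_lt_re (a := a) ⟨h0, by linarith⟩ hs
  have hB := hasSum_hurwitzZeta_of_one_lt_re (a := a + 1 / 2) ⟨by linarith, by linarith⟩ hs
  have hC := (hasSum_hurwitzZeta_of_one_lt_re (a := 2 * a) ⟨by linarith, by linarith⟩ hs).mul_left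
    (2 ^ s)
  have h2s : (2 : ℂ) ^ s ≠ 0 := by simp [Complex.cpow_eq_zero_iff]
  have aux (b : ℝ) (hb : 0 ≤ b) : 2 ^ s * (1 / (2 * b : ℂ) ^ s) = 1 / (b : ℂ) ^ s := by
    have := mul_cpow_ofReal_nonneg (zero_le_two (α := ℝ)) hb s
    rw [ofReal_ofNat] at this
    rw [this, one_div, mul_inv, ← mul_assoc, mul_inv_cancel₀ h2s, one_mul, one_div]
  refine (HasSum.even_add_odd ?_ ?_).unique hC
  · refine hA.congr_fun fun k => ?_
    have := aux (k + a) (by positivity)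
    push_cast at this ⊢
    rw [← this, mul_add]
  · refine hB.congr_fun fun k => ?_
    have := aux (k + (a + 1 / 2)) (by positivity)
    push_cast at this ⊢
    rw [← this]
    ring_nf

lemma coe_one_sub_unitAddCircle (a : ℝ) :
    ((1 - a : ℝ) : UnitAddCircle) = -(a : UnitAddCircle) := by
  rw [AddCircle.coe_sub, AddCircle.coe_period, zero_sub]

/-- Duplication formula for the odd Hurwitz zeta function. -/
lemma hurwitzZetaOdd_add_hurwitzZetaOdd_add_half {a : ℝ} (ha : a ∈ Set.Icc 0 (1 / 2)) (s : ℂ) :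
    hurwitzZetaOdd (a : UnitAddCircle) s + hurwitzZetaOdd ((a + 1 / 2 : ℝ) : UnitAddCircle) s
      = 2 ^ s * hurwitzZetaOdd ((2 * a : ℝ) : UnitAddCircle) s := by
  have h1 : Differentiable ℂ fun s => hurwitzZetaOdd (a : UnitAddCircle) s
      + hurwitzZetaOdd ((a + 1 / 2 : ℝ) : UnitAddCircle) s :=
    (differentiable_hurwitzZetaOdd _).add (differentiable_hurwitzZetaOdd _)
  have h2 : Differentiable ℂ fun s : ℂ => 2 ^ s * hurwitzZetaOdd ((2 * a : ℝ) : UnitAddCircle) s :=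
    Differentiable.mul
      (fun s => DifferentiableAt.const_cpow differentiableAt_id (Or.inl two_ne_zero))
      (differentiable_hurwitzZetaOdd _)
  refine congrFun (AnalyticOnNhd.eq_of_eventuallyEq (z₀ := 2)
    (h1.differentiableOn.analyticOnNhd isOpen_univ)
    (h2.differentiableOn.analyticOnNhd isOpen_univ) ?_) s
  filter_upwards [(isOpen_lt continuous_const continuous_re).mem_nhds
    (show (1 : ℝ) < (2 : ℂ).re by norm_num)] with z hz
  have e1 := hurwitzZeta_add_hurwitzZeta_add_half ha hz
  have e2 := hurwitzZeta_add_hurwitzZeta_add_half (a := 1 / 2 - a)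
    ⟨by linarith [ha.2], by linarith [ha.1]⟩ hz
  have c1 : ((1 / 2 - a : ℝ) : UnitAddCircle) = -((a + 1 / 2 : ℝ) : UnitAddCircle) := by
    rw [← coe_one_sub_unitAddCircle]; congr 1; ring
  have c2 : ((1 / 2 - a + 1 / 2 : ℝ) : UnitAddCircle) = -(a : UnitAddCircle) := by
    rw [← coe_one_sub_unitAddCircle]; congr 1; ring
  have c3 : ((2 * (1 / 2 - a) : ℝ) : UnitAddCircle) = -((2 * a : ℝ) : UnitAddCircle) := by
    rw [← coe_one_sub_unitAddCircle]; congr 1; ring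
  rw [c1, c2, c3] at e2
  simp only [hurwitzZetaOdd_eq]
  linear_combination (e1 - e2) / 2

lemma abs_rpow_neg_sub_rpow_neg_le {c u v σ : ℝ} (hc : 0 < c) (hu : c ≤ u) (hv : c ≤ v)
    (hσ : σ ∈ Set.Icc 1 2) :
    |u ^ (-σ) - v ^ (-σ)| ≤ 2 * (1 / |c| ^ (2 : ℝ) + 1 / |c| ^ (3 : ℝ)) * |u - v| := by
  have hder : ∀ t ∈ Set.Ici c, HasDerivWithinAt (fun t : ℝ => t ^ (-σ))
      (-σ * t ^ (-σ - 1)) (Set.Ici c) t := fun t ht =>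
    (Real.hasDerivAt_rpow_const (Or.inl (hc.trans_le ht).ne')).hasDerivWithinAt
  refine (convex_Ici c).norm_image_sub_le_of_norm_hasDerivWithin_le hder (fun t ht => ?_) hv hu
  have ht0 : 0 < t := hc.trans_le ht
  obtain ⟨h1, h2⟩ := hσ
  rw [norm_mul, norm_neg, Real.norm_of_nonneg (by linarith : (0 : ℝ) ≤ σ),
    Real.norm_of_nonneg (by positivity), abs_of_pos hc]
  refine mul_le_mul h2 ?_ (by positivity) zero_le_two
  refine (Real.rpow_le_rpow_of_nonpos hc ht (by linarith)).trans ?_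
  rw [one_div, one_div, ← Real.rpow_neg hc.le, ← Real.rpow_neg hc.le]
  rcases le_total 1 c with h | h
  · exact (Real.rpow_le_rpow_of_exponent_le h (by linarith)).trans
      (le_add_of_nonneg_right (by positivity))
  · exact (Real.rpow_le_rpow_of_exponent_ge hc h (by linarith)).trans
      (le_add_of_nonneg_left (by positivity))

/-- Mittag-Leffler expansion of the cotangent, with the poles paired as `-n` and `n + 1`. -/
lemma tendsto_sum_one_div_sub_one_div_cot {y : ℝ} (h0 : 0 < y) (h1 : y < 1) :
    Tendsto (fun N : ℕ => ∑ n ∈ Finset.range N, (1 / (n + y : ℂ) - 1 / (n + 1 - y : ℂ)) / 2) atTop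
      (𝓝 (π / 2 * Complex.cot (π * y))) := by
  have hy : (y : ℂ) ∈ Complex.integerComplement := by
    rintro ⟨n, hn⟩
    have hn' : (n : ℝ) = y := by exact_mod_cast hn
    have a1 : (0 : ℝ) < n := hn' ▸ h0
    have a2 : (n : ℝ) < 1 := hn' ▸ h1
    norm_cast at a1 a2
    omega
  have hlim : Tendsto (fun N : ℕ => 1 / ((N : ℂ) + y)) atTop (𝓝 0) := by
    have : Tendsto (fun N : ℕ => 1 / ((N : ℝ) + y)) atTop (𝓝 0) := by
      simp_rw [one_div]
      exact (tendsto_natCast_atTop_atTop.atTop_add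
        (tendsto_const_nhds (x := y))).inv_tendsto_atTop
    exact_mod_cast (continuous_ofReal.tendsto 0).comp this
  have hfin (N : ℕ) : ∑ n ∈ Finset.range N, (1 / (n + y : ℂ) - 1 / (n + 1 - y : ℂ)) / 2
      = (∑ n ∈ Finset.range N, cotTerm y n + 1 / y - 1 / ((N : ℂ) + y)) / 2 := by
    induction N with
    | zero => simp
    | succ N ih =>
      rw [Finset.sum_range_succ, Finset.sum_range_succ, ih, cotTerm,
        ← neg_sub (y : ℂ) (N + 1), one_div_neg_eq_neg_one_div]
      push_cast
      rw [add_comm (y : ℂ) (N + 1)]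
      ring
  simp_rw [hfin]
  convert! (((tendsto_logDeriv_euler_cot_sub hy).add_const (1 / (y : ℂ))).sub hlim).div_const 2
    using 2
  ring

/-- The value at `s = 1` of the odd Hurwitz zeta function. -/
lemma hurwitzZetaOdd_one {y : ℝ} (h0 : 0 < y) (h1 : y < 1) :
    hurwitzZetaOdd (y : UnitAddCircle) 1 = π / 2 * Complex.cot (π * y) := by
  obtain ⟨m, hm0, hm1, hm2⟩ : ∃ m : ℝ, 0 < m ∧ m ≤ y ∧ m ≤ 1 - y :=
    ⟨min y (1 - y), lt_min h0 (by linarith), min_le_left _ _, min_le_right _ _⟩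
  set F : ℝ → ℕ → ℂ := fun σ n =>
    (1 / (n + y : ℂ) ^ (σ : ℂ) - 1 / (n + 1 - y : ℂ) ^ (σ : ℂ)) / 2 with hF
  set B : ℕ → ℝ := fun n => 2 * (1 / |(n : ℝ) + m| ^ (2 : ℝ) + 1 / |(n : ℝ) + m| ^ (3 : ℝ))
  have hBsum : Summable B :=
    (((Real.summable_one_div_nat_add_rpow m 2).2 (by norm_num)).add
      ((Real.summable_one_div_nat_add_rpow m 3).2 (by norm_num))).mul_left 2
  have hFB : ∀ σ ∈ Set.Icc (1 : ℝ) 2, ∀ n, ‖F σ n‖ ≤ B n := by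
    intro σ hσ n
    have hn : (0 : ℝ) ≤ n := n.cast_nonneg
    have hp : 0 < (n : ℝ) + y := by linarith
    have hq : 0 < (n : ℝ) + 1 - y := by linarith
    have e : F σ n = ((((n : ℝ) + y) ^ (-σ) - ((n : ℝ) + 1 - y) ^ (-σ)) / 2 : ℝ) := by
      simp only [hF]
      rw [Real.rpow_neg hp.le, Real.rpow_neg hq.le]
      push_cast [ofReal_cpow hp.le, ofReal_cpow hq.le]
      simp
    have hle := abs_rpow_neg_sub_rpow_neg_le (c := n + m) (u := n + y) (v := n + 1 - y)
      (by positivity) (by linarith) (by linarith) hσ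
    have hd : |(n + y : ℝ) - (n + 1 - y)| ≤ 1 := by rw [abs_le]; constructor <;> linarith
    have hBn : 0 ≤ B n := by positivity
    rw [e, norm_real, Real.norm_eq_abs, abs_div, abs_two]
    have : B n * |(n + y : ℝ) - (n + 1 - y)| ≤ B n * 1 := by gcongr
    have h3 : |((n : ℝ) + y) ^ (-σ) - ((n : ℝ) + 1 - y) ^ (-σ)| ≤ B n := by linarith
    linarith [abs_nonneg (((n : ℝ) + y) ^ (-σ) - ((n : ℝ) + 1 - y) ^ (-σ))]
  have hmem : ∀ᶠ σ : ℝ in 𝓝[>] 1, σ ∈ Set.Ioo (1 : ℝ) 2 := Ioo_mem_nhdsGT (by norm_num)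
  have hterm : ∀ n, Tendsto (F · n) (𝓝[>] 1) (𝓝 (F 1 n)) := by
    intro n
    have hn : (0 : ℝ) ≤ n := n.cast_nonneg
    have hp : ((n : ℂ) + y) ≠ 0 := by
      have : (n : ℝ) + y ≠ 0 := by linarith
      exact_mod_cast this
    have hq : ((n : ℂ) + 1 - y) ≠ 0 := by
      have : (n : ℝ) + 1 - y ≠ 0 := by linarith
      exact_mod_cast this
    have hc : Continuous (F · n) := by
      simp only [hF]
      refine ((continuous_const.div (continuous_ofReal.const_cpow (Or.inl hp)) ?_).sub
        (continuous_const.div (continuous_ofReal.const_cpow (Or.inl hq)) ?_)).div_const 2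
      · intro σ; simp [Complex.cpow_eq_zero_iff, hp]
      · intro σ; simp [Complex.cpow_eq_zero_iff, hq]
    exact (hc.tendsto 1).mono_left nhdsWithin_le_nhds
  have hlim := tendsto_tsum_of_dominated_convergence hBsum hterm
    (hmem.mono fun σ hσ => hFB σ ⟨hσ.1.le, hσ.2.le⟩)
  have hlim' : Tendsto (fun σ : ℝ => ∑' n, F σ n) (𝓝[>] 1)
      (𝓝 (hurwitzZetaOdd (y : UnitAddCircle) 1)) := by
    have hc : Continuous fun σ : ℝ => hurwitzZetaOdd (y : UnitAddCircle) (σ : ℂ) :=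
      (differentiable_hurwitzZetaOdd _).continuous.comp continuous_ofReal
    have := (hc.tendsto 1).mono_left (nhdsWithin_le_nhds (s := Set.Ioi 1))
    rw [ofReal_one] at this
    refine this.congr' (hmem.mono fun σ hσ => ?_)
    exact (hasSum_nat_hurwitzZetaOdd_of_mem_Icc ⟨h0.le, h1.le⟩
      (s := σ) (by simpa using hσ.1)).tsum_eq.symm
  rw [tendsto_nhds_unique hlim' hlim]
  have hs : Summable (F 1) := .of_norm_bounded hBsum (hFB 1 ⟨le_rfl, by norm_num⟩)
  refine tendsto_nhds_unique hs.hasSum.tendsto_sum_nat ?_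
  simpa [hF] using tendsto_sum_one_div_sub_one_div_cot h0 h1

/-- For `0 < x < 1/2`,
`γ₁(1/2 - x) - γ₁(x + 1/2)
  = -2[γ₁(2x) - γ₁(1 - 2x)] + [γ₁(x) - γ₁(1 - x)] + 2π log 2 · cot(2πx)`. -/
theorem stieltjes_gamma1_functional_equation (x : ℝ) (hx0 : 0 < x) (hx1 : x < 1 / 2) :
    stieltjesGamma1 (1 / 2 - x) - stieltjesGamma1 (x + 1 / 2)
      = -2 * (stieltjesGamma1 (2 * x) - stieltjesGamma1 (1 - 2 * x))
        + (stieltjesGamma1 x - stieltjesGamma1 (1 - x))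
        + ((2 * π * Real.log 2 * (Real.cos (2 * π * x) / Real.sin (2 * π * x)) : ℝ) : ℂ) := by
  have g1 : stieltjesGamma1 (1 / 2 - x) - stieltjesGamma1 (x + 1 / 2)
      = 2 * deriv (hurwitzZetaOdd ((x + 1 / 2 : ℝ) : UnitAddCircle)) 1 := by
    have := stieltjesGamma1_sub_of_coe_eq_neg (a := x + 1 / 2) (b := 1 / 2 - x)
      (by rw [← coe_one_sub_unitAddCircle]; congr 1; ring)
    linear_combination -this
  have g2 := stieltjesGamma1_sub_of_coe_eq_neg (coe_one_sub_unitAddCircle (2 * x))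
  have g3 := stieltjesGamma1_sub_of_coe_eq_neg (coe_one_sub_unitAddCircle x)
  have hdup : deriv (hurwitzZetaOdd (x : UnitAddCircle)) 1
      + deriv (hurwitzZetaOdd ((x + 1 / 2 : ℝ) : UnitAddCircle)) 1
      = 2 * Complex.log 2 * hurwitzZetaOdd ((2 * x : ℝ) : UnitAddCircle) 1
        + 2 * deriv (hurwitzZetaOdd ((2 * x : ℝ) : UnitAddCircle)) 1 := by
    have hfun := funext (hurwitzZetaOdd_add_hurwitzZetaOdd_add_half
      (a := x) ⟨hx0.le, hx1.le⟩)
    have hl := ((differentiable_hurwitzZetaOdd (x : UnitAddCircle) 1).hasDerivAt.add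
      (differentiable_hurwitzZetaOdd ((x + 1 / 2 : ℝ) : UnitAddCircle) 1).hasDerivAt)
    have hr := ((hasDerivAt_id (1 : ℂ)).const_cpow (c := 2) (Or.inl two_ne_zero)).mul
      (differentiable_hurwitzZetaOdd ((2 * x : ℝ) : UnitAddCircle) 1).hasDerivAt
    have := hl.unique (hr.congr_of_eventuallyEq (.of_eq hfun))
    simpa using this
  have hcot := hurwitzZetaOdd_one (y := 2 * x) (by linarith) (by linarith)
  have hlog : Complex.log 2 = (Real.log 2 : ℝ) := by simp
  rw [g1, g2, g3]
  rw [hcot, hlog, Complex.cot_eq_cos_div_sin] at hdup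
  push_cast at hdup ⊢
  rw [show (π : ℂ) * (2 * x) = 2 * π * x by ring] at hdup
  linear_combination 2 * hdup
end

section
/- For all real x > 0, the second s-derivative of the Hurwitz zeta function at s = 0 satisfies ζ''(0, x + 1/2) = ζ''(0, 2x) − ζ''(0, x) + 2 log 2 · (log Γ(2x) − (1/2) log(2π)) + log²2 · (1/2 − 2x). -/
open Real Complex Filter Topology

/-- The error of the trapezoidal rule on `[a, a + 1]` for the function `t ↦ t ^ (-s)`. -/
noncomputable def trapezoidCpowError (a : ℝ) (s : ℂ) : ℂ :=
  ((a : ℂ) ^ (-s) + ((a : ℂ) + 1) ^ (-s)) / 2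
    - (((a : ℂ) + 1) ^ (1 - s) - (a : ℂ) ^ (1 - s)) / (1 - s)

lemma hasDerivAt_ofReal_add_cpow {a u : ℝ} (h : 0 < a + u) (c : ℂ) :
    HasDerivAt (fun v : ℝ => ((a : ℂ) + v) ^ c) (c * ((a : ℂ) + u) ^ (c - 1)) u := by
  have h1 : HasDerivAt (fun z : ℂ => (a : ℂ) + z) 1 (u : ℂ) := (hasDerivAt_id _).const_add _
  have h2 : (a : ℂ) + u ∈ Complex.slitPlane := by
    rw [← Complex.ofReal_add]
    exact Complex.ofReal_mem_slitPlane.2 h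
  simpa using (h1.cpow_const (c := c) h2).comp_ofReal

lemma norm_trapezoidCpowError_le {a : ℝ} (ha : 0 < a) {s : ℂ} (hs : s ≠ 1) {M : ℝ}
    (hM : ∀ u ∈ Set.Icc (0 : ℝ) 1, ‖s * (s + 1) * ((a : ℂ) + u) ^ (-s - 2)‖ ≤ M) :
    ‖trapezoidCpowError a s‖ ≤ M := by
  have hs' : 1 - s ≠ 0 := sub_ne_zero.2 hs.symm
  have hM0 : 0 ≤ M := (norm_nonneg _).trans (hM 0 ⟨le_rfl, zero_le_one⟩)
  set p : ℝ → ℂ := fun u => (u / 2 : ℂ) * ((a : ℂ) ^ (-s) + ((a : ℂ) + u) ^ (-s))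
    - (((a : ℂ) + u) ^ (1 - s) - (a : ℂ) ^ (1 - s)) / (1 - s) with hp
  set q : ℝ → ℂ := fun u => ((a : ℂ) ^ (-s) - ((a : ℂ) + u) ^ (-s)) / 2
    + (u / 2 : ℂ) * (-s * ((a : ℂ) + u) ^ (-s - 1)) with hq
  have hid : ∀ u : ℝ, HasDerivAt (fun v : ℝ => (v / 2 : ℂ)) (1 / 2) u := fun u =>
    (hasDerivAt_id (u : ℝ)).ofReal_comp.div_const 2
  have hpd : ∀ u ∈ Set.Icc (0 : ℝ) 1, HasDerivAt p (q u) u := by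
    intro u hu
    have hau : 0 < a + u := by linarith [hu.1]
    have := ((hid u).mul ((hasDerivAt_ofReal_add_cpow hau (-s)).const_add ((a : ℂ) ^ (-s)))).sub
      (((hasDerivAt_ofReal_add_cpow hau (1 - s)).sub_const ((a : ℂ) ^ (1 - s))).div_const (1 - s))
    refine this.congr_deriv ?_
    rw [mul_div_cancel_left₀ _ hs', show 1 - s - 1 = -s by ring]
    simp only [hq]
    ring
  have hqd : ∀ u ∈ Set.Icc (0 : ℝ) 1, HasDerivAt q
      ((u / 2 : ℂ) * (s * (s + 1) * ((a : ℂ) + u) ^ (-s - 2))) u := by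
    intro u hu
    have hau : 0 < a + u := by linarith [hu.1]
    have := (((hasDerivAt_ofReal_add_cpow hau (-s)).const_sub ((a : ℂ) ^ (-s))).div_const 2).add
      ((hid u).mul ((hasDerivAt_ofReal_add_cpow hau (-s - 1)).const_mul (-s)))
    refine this.congr_deriv ?_
    rw [show -s - 1 - 1 = -s - 2 by ring]
    ring
  have hqM : ∀ u ∈ Set.Icc (0 : ℝ) 1, ‖q u‖ ≤ M := by
    intro u hu
    have hb : ∀ v ∈ Set.Icc (0 : ℝ) 1,
        ‖(v / 2 : ℂ) * (s * (s + 1) * ((a : ℂ) + v) ^ (-s - 2))‖ ≤ M := by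
      intro v hv
      rw [norm_mul]
      have : ‖(v / 2 : ℂ)‖ ≤ 1 := by
        rw [norm_div, Complex.norm_real, Real.norm_of_nonneg hv.1]
        norm_num
        linarith [hv.2]
      calc _ ≤ 1 * M := mul_le_mul this (hM v hv) (norm_nonneg _) zero_le_one
        _ = M := one_mul M
    have := (convex_Icc (0 : ℝ) 1).norm_image_sub_le_of_norm_hasDerivWithin_le
      (fun v hv => (hqd v hv).hasDerivWithinAt) hb ⟨le_rfl, zero_le_one⟩ hu
    have hq0 : q 0 = 0 := by simp [hq]
    rw [hq0, sub_zero, sub_zero, Real.norm_of_nonneg hu.1] at this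
    nlinarith [hu.2]
  have := norm_image_sub_le_of_norm_deriv_le_segment_01'
    (fun u hu => (hpd u hu).hasDerivWithinAt) (fun u hu => hqM u ⟨hu.1, hu.2.le⟩)
  have hp0 : p 0 = 0 := by simp [hp]
  have hp1 : p 1 = trapezoidCpowError a s := by
    simp only [hp, trapezoidCpowError, Complex.ofReal_one]
    ring
  rwa [hp0, hp1, sub_zero] at this

/-- A convex open region containing `0` and points of real part larger than `1`,
but avoiding the pole `1` of the Hurwitz zeta function. -/
def hurwitzRegion : Set ℂ := {s | s.re - 1 < s.im} ∩ {s | -(1 / 2) < s.re} ∩ Metric.ball 0 10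

lemma isOpen_hurwitzRegion : IsOpen hurwitzRegion :=
  ((isOpen_lt (by fun_prop) (by fun_prop)).inter (isOpen_lt (by fun_prop) (by fun_prop))).inter
    Metric.isOpen_ball

lemma convex_hurwitzRegion : Convex ℝ hurwitzRegion := by
  refine (Convex.inter ?_ ?_).inter (convex_ball _ _)
  · intro x hx y hy a b ha hb hab
    simp only [Set.mem_ofPred_eq, Complex.add_re, Complex.add_im, Complex.real_smul,
      Complex.re_ofReal_mul, Complex.im_ofReal_mul] at *
    rcases ha.eq_or_lt with rfl | ha
    · obtain rfl : b = 1 := by linarith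
      linarith
    · nlinarith
  · exact convex_halfSpace_re_gt _

lemma zero_mem_hurwitzRegion : (0 : ℂ) ∈ hurwitzRegion := by
  simp [hurwitzRegion]

lemma ne_one_of_mem_hurwitzRegion {s : ℂ} (hs : s ∈ hurwitzRegion) : s ≠ 1 := by
  rintro rfl
  simp [hurwitzRegion] at hs

/-- Two functions holomorphic on `hurwitzRegion` agree there if they agree for `1 < re s`. -/
lemma eqOn_hurwitzRegion {f g : ℂ → ℂ} (hf : DifferentiableOn ℂ f hurwitzRegion)
    (hg : DifferentiableOn ℂ g hurwitzRegion)
    (h : ∀ s ∈ hurwitzRegion, 1 < s.re → f s = g s) : Set.EqOn f g hurwitzRegion := by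
  have hz : (2 + 3 * Complex.I : ℂ) ∈ hurwitzRegion := by
    refine ⟨⟨?_, ?_⟩, ?_⟩
    · simp; norm_num
    · simp; norm_num
    · rw [mem_ball_zero_iff]
      refine (norm_add_le _ _).trans_lt ?_
      simp
      norm_num
  refine (hf.analyticOnNhd isOpen_hurwitzRegion).eqOn_of_preconnected_of_eventuallyEq
    (hg.analyticOnNhd isOpen_hurwitzRegion) convex_hurwitzRegion.isPreconnected hz ?_
  have h1 : {s : ℂ | 1 < s.re} ∈ 𝓝 (2 + 3 * Complex.I : ℂ) :=
    (isOpen_lt continuous_const Complex.continuous_re).mem_nhds (by simp)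
  filter_upwards [h1, isOpen_hurwitzRegion.mem_nhds hz] with s h1 h2 using h s h2 h1

lemma differentiableAt_trapezoidCpowError {a : ℝ} (ha : 0 < a) {s : ℂ} (hs : s ≠ 1) :
    DifferentiableAt ℂ (trapezoidCpowError a) s := by
  have h0 : (a : ℂ) ≠ 0 := by exact_mod_cast ha.ne'
  have h1 : (a : ℂ) + 1 ≠ 0 := by exact_mod_cast (by linarith : a + 1 ≠ 0)
  have hs' : 1 - s ≠ 0 := sub_ne_zero.2 hs.symm
  unfold trapezoidCpowError
  fun_prop (disch := simp [h0, h1, hs'])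

lemma norm_trapezoidCpowError_natCast_add_le {y : ℝ} (hy : 0 < y) {s : ℂ}
    (hs : s ∈ hurwitzRegion) (n : ℕ) :
    ‖trapezoidCpowError (n + y) s‖
      ≤ 110 * (min 1 y) ^ (-11 : ℝ) * (1 / |(n : ℝ) + y| ^ (3 / 2 : ℝ)) := by
  have ha : 0 < (n : ℝ) + y := by positivity
  have hm : 0 < min 1 y := lt_min one_pos hy
  refine norm_trapezoidCpowError_le ha (ne_one_of_mem_hurwitzRegion hs) fun u hu => ?_
  have hau : 0 < (n : ℝ) + y + u := by linarith [hu.1]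
  have hs10 : ‖s‖ < 10 := by simpa using hs.2
  have hre : -(1 / 2) < s.re := hs.1.2
  have hre10 : s.re < 10 := (Complex.re_le_norm s).trans_lt hs10
  rw [norm_mul, norm_mul, ← Complex.ofReal_add, Complex.norm_cpow_eq_rpow_re_of_pos hau]
  have e1 : ‖s‖ * ‖s + 1‖ ≤ 110 := by
    have : ‖s + 1‖ ≤ 11 := (norm_add_le _ _).trans (by simp; linarith)
    nlinarith [norm_nonneg s, norm_nonneg (s + 1)]
  have e2 : ((n : ℝ) + y + u) ^ (-s - 2 : ℂ).re
      ≤ (min 1 y) ^ (-11 : ℝ) * (1 / |(n : ℝ) + y| ^ (3 / 2 : ℝ)) := by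
    have : (-s - 2 : ℂ).re = -(s.re + 1 / 2) + -(3 / 2) := by simp; ring
    rw [this, Real.rpow_add hau, abs_of_pos ha, one_div (((n : ℝ) + y) ^ (3 / 2 : ℝ)),
      ← Real.rpow_neg ha.le]
    refine mul_le_mul ?_ ?_ (by positivity) (by positivity)
    · calc ((n : ℝ) + y + u) ^ (-(s.re + 1 / 2)) ≤ (min 1 y) ^ (-(s.re + 1 / 2)) := by
            refine Real.rpow_le_rpow_of_nonpos hm ?_ (by linarith)
            linarith [min_le_right 1 y, hu.1, (Nat.cast_nonneg n : (0 : ℝ) ≤ n)]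
        _ ≤ (min 1 y) ^ (-11 : ℝ) :=
            Real.rpow_le_rpow_of_exponent_ge hm (min_le_left _ _) (by linarith)
    · exact Real.rpow_le_rpow_of_nonpos ha (by linarith [hu.1]) (by norm_num)
  rw [mul_assoc (110 : ℝ)]
  exact mul_le_mul e1 e2 (by positivity) (by norm_num)

lemma summable_trapezoidCpowError_bound (y : ℝ) :
    Summable fun n : ℕ => 110 * (min 1 y) ^ (-11 : ℝ) * (1 / |(n : ℝ) + y| ^ (3 / 2 : ℝ)) :=
  ((Real.summable_one_div_nat_add_rpow y (3 / 2)).2 (by norm_num)).mul_left _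

lemma summable_natCast_add_cpow_neg {y : ℝ} (hy : 0 < y) {s : ℂ} (hs : 1 < s.re) :
    Summable fun n : ℕ => ((n : ℂ) + (y : ℂ)) ^ (-s) := by
  refine Summable.of_norm (((Real.summable_one_div_nat_add_rpow y s.re).2 hs).congr fun n => ?_)
  have ha : 0 < (n : ℝ) + y := by positivity
  rw [← Complex.ofReal_natCast, ← Complex.ofReal_add, Complex.norm_cpow_eq_rpow_re_of_pos ha,
    abs_of_pos ha, Complex.neg_re, Real.rpow_neg ha.le, one_div]

lemma tendsto_natCast_add_cpow_zero (y : ℝ) {c : ℂ} (hc : c.re < 0) :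
    Tendsto (fun n : ℕ => ((n : ℂ) + (y : ℂ)) ^ c) atTop (𝓝 0) := by
  have hlim : Tendsto (fun n : ℕ => (n : ℝ) + y) atTop atTop :=
    tendsto_atTop_add_const_right _ _ tendsto_natCast_atTop_atTop
  rw [tendsto_zero_iff_norm_tendsto_zero]
  have h := (tendsto_rpow_neg_atTop (neg_pos.2 hc)).comp hlim
  refine h.congr' ?_
  filter_upwards [hlim.eventually_gt_atTop 0] with n hn
  rw [← Complex.ofReal_natCast, ← Complex.ofReal_add, Complex.norm_cpow_eq_rpow_re_of_pos hn]
  simp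

lemma sum_trapezoidCpowError (y : ℝ) (s : ℂ) (N : ℕ) :
    ∑ n ∈ Finset.range N, trapezoidCpowError (n + y) s
      = ∑ n ∈ Finset.range N, ((n : ℂ) + y) ^ (-s)
        + (((N : ℂ) + y) ^ (-s) - (y : ℂ) ^ (-s)) / 2
        - (((N : ℂ) + y) ^ (1 - s) - (y : ℂ) ^ (1 - s)) / (1 - s) := by
  induction N with
  | zero => simp
  | succ N ih =>
    rw [Finset.sum_range_succ, ih, Finset.sum_range_succ, trapezoidCpowError]
    push_cast
    rw [show (N : ℂ) + y + 1 = N + 1 + y by ring]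
    ring

lemma tsum_trapezoidCpowError {y : ℝ} (hy : 0 < y) {s : ℂ} (hs : s ∈ hurwitzRegion)
    (hs1 : 1 < s.re) :
    ∑' n : ℕ, trapezoidCpowError (n + y) s
      = ∑' n : ℕ, ((n : ℂ) + (y : ℂ)) ^ (-s) - (y : ℂ) ^ (-s) / 2
        + (y : ℂ) ^ (1 - s) / (1 - s) := by
  have hsum : Summable fun n : ℕ => trapezoidCpowError (n + y) s :=
    Summable.of_norm_bounded (summable_trapezoidCpowError_bound y)
      (norm_trapezoidCpowError_natCast_add_le hy hs)
  refine tendsto_nhds_unique hsum.hasSum.tendsto_sum_nat ?_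
  simp only [sum_trapezoidCpowError]
  have h1 := (summable_natCast_add_cpow_neg hy hs1).hasSum.tendsto_sum_nat
  have h2 := tendsto_natCast_add_cpow_zero y (c := -s) (by simp; linarith)
  have h3 := tendsto_natCast_add_cpow_zero y (c := 1 - s) (by simp; linarith)
  convert (h1.add ((h2.sub_const ((y : ℂ) ^ (-s))).div_const 2)).sub
    ((h3.sub_const ((y : ℂ) ^ (1 - s))).div_const (1 - s)) using 2
  ring

lemma differentiableOn_tsum_trapezoidCpowError {y : ℝ} (hy : 0 < y) :
    DifferentiableOn ℂ (fun s => ∑' n : ℕ, trapezoidCpowError (n + y) s) hurwitzRegion :=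
  Complex.differentiableOn_tsum_of_summable_norm (summable_trapezoidCpowError_bound y)
    (fun n _ hs => (differentiableAt_trapezoidCpowError (by positivity)
      (ne_one_of_mem_hurwitzRegion hs)).differentiableWithinAt)
    isOpen_hurwitzRegion fun n _ hs => norm_trapezoidCpowError_natCast_add_le hy hs n

lemma hasDerivAt_ofReal_cpow_neg_zero {a : ℝ} (ha : 0 < a) :
    HasDerivAt (fun s : ℂ => (a : ℂ) ^ (-s)) (-(Real.log a : ℂ)) 0 := by
  have h0 : (a : ℂ) ≠ 0 := by exact_mod_cast ha.ne'
  refine ((hasDerivAt_neg (0 : ℂ)).const_cpow (Or.inl h0)).congr_deriv ?_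
  simp [Complex.ofReal_log ha.le]

lemma hasDerivAt_ofReal_cpow_one_sub_div_zero {a : ℝ} (ha : 0 < a) :
    HasDerivAt (fun s : ℂ => (a : ℂ) ^ (1 - s) / (1 - s)) ((a - a * Real.log a : ℝ) : ℂ) 0 := by
  have h0 : (a : ℂ) ≠ 0 := by exact_mod_cast ha.ne'
  have h1 : HasDerivAt (fun s : ℂ => 1 - s) (-1) 0 := (hasDerivAt_id (0 : ℂ)).const_sub 1
  refine ((h1.const_cpow (Or.inl h0)).div h1 (by simp)).congr_deriv ?_
  simp [Complex.ofReal_log ha.le]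
  ring

lemma trapezoidCpowError_zero (a : ℝ) : trapezoidCpowError a 0 = 0 := by
  simp [trapezoidCpowError]

lemma deriv_trapezoidCpowError_zero {a : ℝ} (ha : 0 < a) :
    deriv (trapezoidCpowError a) 0
      = (((a + 1) * Real.log (a + 1) - a * Real.log a - 1
          - (Real.log a + Real.log (a + 1)) / 2 : ℝ) : ℂ) := by
  have ha1 : 0 < a + 1 := by linarith
  have h := (((hasDerivAt_ofReal_cpow_neg_zero ha).add
    (hasDerivAt_ofReal_cpow_neg_zero ha1)).div_const 2).sub
    ((hasDerivAt_ofReal_cpow_one_sub_div_zero ha1).sub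
      (hasDerivAt_ofReal_cpow_one_sub_div_zero ha))
  have he : trapezoidCpowError a = fun s : ℂ => ((a : ℂ) ^ (-s) + ((a + 1 : ℝ) : ℂ) ^ (-s)) / 2
      - (((a + 1 : ℝ) : ℂ) ^ (1 - s) / (1 - s) - (a : ℂ) ^ (1 - s) / (1 - s)) := by
    funext s
    rw [trapezoidCpowError, sub_div]
    push_cast
    rfl
  rw [he]
  refine h.deriv.trans ?_
  push_cast
  ring

lemma sum_log_natCast_add (y : ℝ) (N : ℕ) :
    ∑ n ∈ Finset.range N, (((n + y) + 1) * Real.log ((n + y) + 1) - (n + y) * Real.log (n + y) - 1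
        - (Real.log (n + y) + Real.log ((n + y) + 1)) / 2)
      = (N + y - 1 / 2) * Real.log (N + y) - (y - 1 / 2) * Real.log y - N
        - ∑ n ∈ Finset.range N, Real.log (y + n) := by
  induction N with
  | zero => simp
  | succ N ih =>
    rw [Finset.sum_range_succ, ih, Finset.sum_range_succ]
    push_cast
    rw [show (N : ℝ) + 1 + y = N + y + 1 by ring, add_comm y (N : ℝ)]
    ring

/-- Stirling's formula for the partial products of `Γ y`. -/
lemma tendsto_sub_sum_log_natCast_add {y : ℝ} (hy : 0 < y) :
    Tendsto (fun N : ℕ => (N + y - 1 / 2) * Real.log (N + y) - N - y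
        - ∑ n ∈ Finset.range N, Real.log (y + n)) atTop
      (𝓝 (Real.log (Real.Gamma y) - 1 / 2 * Real.log (2 * π))) := by
  have hG := Real.BohrMollerup.tendsto_log_gamma hy
  have hS : Tendsto (fun N : ℕ => Real.log (Stirling.stirlingSeq N)) atTop
      (𝓝 (Real.log (√π))) :=
    Stirling.tendsto_stirlingSeq_sqrt_pi.log (Real.sqrt_pos.2 Real.pi_pos).ne'
  have h1 := (Real.tendsto_mul_log_one_add_div_atTop y).comp (tendsto_natCast_atTop_atTop (R := ℝ))
  have h2 : Tendsto (fun N : ℕ => Real.log (1 + y / N)) atTop (𝓝 0) := by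
    have : Tendsto (fun N : ℕ => 1 + y / N) atTop (𝓝 (1 + 0)) :=
      (tendsto_const_div_atTop_nhds_zero_nat y).const_add 1
    simpa using this.log (by simp)
  have h := ((hG.sub hS).sub_const (Real.log 2 / 2)).add
    ((h1.add (h2.const_mul (y + 1 / 2))).sub_const y)
  have hlim : Real.log (Real.Gamma y) - Real.log (√π) - Real.log 2 / 2
      + (y + (y + 1 / 2) * 0 - y) = Real.log (Real.Gamma y) - 1 / 2 * Real.log (2 * π) := by
    rw [Real.log_sqrt Real.pi_pos.le, Real.log_mul two_ne_zero Real.pi_ne_zero]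
    ring
  rw [hlim] at h
  refine h.congr' ?_
  filter_upwards [eventually_gt_atTop 0] with N hN
  have hN' : (0 : ℝ) < N := by exact_mod_cast hN
  have hadd : 1 + y / N = (N + y) / N := by field_simp
  simp only [Function.comp_apply]
  rw [hadd, Real.log_div (by positivity) hN'.ne', Stirling.log_stirlingSeq_formula,
    Real.log_mul two_ne_zero hN'.ne', Real.log_div hN'.ne' (Real.exp_pos 1).ne', Real.log_exp,
    Real.BohrMollerup.logGammaSeq, Finset.sum_range_succ, add_comm y (N : ℝ)]
  ring

section Continuation

variable {Z : ℂ → ℂ} {y : ℝ}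

lemma hurwitz_continuation_eq (hy : 0 < y) (hZ : ∀ s : ℂ, s ≠ 1 → DifferentiableAt ℂ Z s)
    (hser : ∀ s : ℂ, 1 < s.re → Z s = ∑' n : ℕ, ((n : ℂ) + (y : ℂ)) ^ (-s)) :
    Set.EqOn Z (fun s => ∑' n : ℕ, trapezoidCpowError (n + y) s + (y : ℂ) ^ (-s) / 2
      - (y : ℂ) ^ (1 - s) / (1 - s)) hurwitzRegion := by
  have h0 : (y : ℂ) ≠ 0 := by exact_mod_cast hy.ne'
  refine eqOn_hurwitzRegion
    (fun s hs => (hZ s (ne_one_of_mem_hurwitzRegion hs)).differentiableWithinAt) ?_ ?_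
  · refine ((differentiableOn_tsum_trapezoidCpowError hy).add fun s _ => ?_).sub fun s hs => ?_
    · exact DifferentiableAt.differentiableWithinAt (by fun_prop (disch := simp [h0]))
    · have : 1 - s ≠ 0 := sub_ne_zero.2 (ne_one_of_mem_hurwitzRegion hs).symm
      exact DifferentiableAt.differentiableWithinAt (by fun_prop (disch := simp [h0, this]))
  · intro s hs hs1
    rw [tsum_trapezoidCpowError hy hs hs1, hser s hs1]
    ring

/-- `ζ(0, y) = 1 / 2 - y`. -/
lemma hurwitz_continuation_apply_zero (hy : 0 < y)
    (hZ : ∀ s : ℂ, s ≠ 1 → DifferentiableAt ℂ Z s)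
    (hser : ∀ s : ℂ, 1 < s.re → Z s = ∑' n : ℕ, ((n : ℂ) + (y : ℂ)) ^ (-s)) :
    Z 0 = ((1 / 2 - y : ℝ) : ℂ) := by
  rw [hurwitz_continuation_eq hy hZ hser zero_mem_hurwitzRegion]
  simp [trapezoidCpowError_zero]

/-- Lerch's formula `ζ'(0, y) = log Γ(y) - (1 / 2) log (2π)`. -/
lemma deriv_hurwitz_continuation_zero (hy : 0 < y)
    (hZ : ∀ s : ℂ, s ≠ 1 → DifferentiableAt ℂ Z s)
    (hser : ∀ s : ℂ, 1 < s.re → Z s = ∑' n : ℕ, ((n : ℂ) + (y : ℂ)) ^ (-s)) :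
    deriv Z 0 = ((Real.log (Real.Gamma y) - 1 / 2 * Real.log (2 * π) : ℝ) : ℂ) := by
  have hnhds := isOpen_hurwitzRegion.mem_nhds zero_mem_hurwitzRegion
  have hT : HasSum (fun n : ℕ => deriv (trapezoidCpowError (n + y)) 0)
      (deriv (fun s => ∑' n : ℕ, trapezoidCpowError (n + y) s) 0) :=
    Complex.hasSum_deriv_of_summable_norm (summable_trapezoidCpowError_bound y)
      (fun n _ hs => (differentiableAt_trapezoidCpowError (by positivity)
        (ne_one_of_mem_hurwitzRegion hs)).differentiableWithinAt)
      isOpen_hurwitzRegion (fun n _ hs => norm_trapezoidCpowError_natCast_add_le hy hs n)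
      zero_mem_hurwitzRegion
  have hd := ((((differentiableOn_tsum_trapezoidCpowError hy).differentiableAt hnhds).hasDerivAt.add
    ((hasDerivAt_ofReal_cpow_neg_zero hy).div_const 2)).sub
    (hasDerivAt_ofReal_cpow_one_sub_div_zero hy))
  have hZd : deriv Z 0 = deriv (fun s => ∑' n : ℕ, trapezoidCpowError (n + y) s) 0
      + -(Real.log y : ℂ) / 2 - ((y - y * Real.log y : ℝ) : ℂ) := by
    rw [((hurwitz_continuation_eq hy hZ hser).eventuallyEq_of_mem hnhds).deriv_eq]
    exact hd.deriv
  rw [hZd]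
  refine tendsto_nhds_unique ((hT.tendsto_sum_nat.add_const _).sub_const _)
    (((Complex.continuous_ofReal.tendsto _).comp (tendsto_sub_sum_log_natCast_add hy)).congr
      fun N => ?_)
  rw [Finset.sum_congr rfl fun (n : ℕ) _ =>
      deriv_trapezoidCpowError_zero (a := n + y) (by positivity),
    ← Complex.ofReal_sum, sum_log_natCast_add, Function.comp_apply]
  push_cast
  ring

end Continuation

lemma tsum_natCast_add_cpow_neg_add_half {x : ℝ} (hx : 0 < x) {s : ℂ} (hs : 1 < s.re) :
    ∑' n : ℕ, ((n : ℂ) + ((x + 1 / 2 : ℝ) : ℂ)) ^ (-s)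
      = 2 ^ s * ∑' n : ℕ, ((n : ℂ) + ((2 * x : ℝ) : ℂ)) ^ (-s)
        - ∑' n : ℕ, ((n : ℂ) + (x : ℂ)) ^ (-s) := by
  have h2 : (2 : ℂ) ^ s * 2 ^ (-s) = 1 := by
    rw [← Complex.cpow_add _ _ two_ne_zero, add_neg_cancel, Complex.cpow_zero]
  have hmul : ∀ a : ℝ, 0 ≤ a → (2 : ℂ) ^ s * (((2 * a : ℝ) : ℂ)) ^ (-s) = (a : ℂ) ^ (-s) := by
    intro a ha
    rw [Complex.ofReal_mul, Complex.mul_cpow_ofReal_nonneg zero_le_two ha, ← mul_assoc,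
      Complex.ofReal_ofNat, h2, one_mul]
  have heven : ∀ n : ℕ, (2 : ℂ) ^ s * (((2 * n : ℕ) : ℂ) + ((2 * x : ℝ) : ℂ)) ^ (-s)
      = ((n : ℂ) + (x : ℂ)) ^ (-s) := by
    intro n
    have := hmul (n + x) (by positivity)
    push_cast at this ⊢
    rw [← this]
    ring_nf
  have hodd : ∀ n : ℕ, (2 : ℂ) ^ s * (((2 * n + 1 : ℕ) : ℂ) + ((2 * x : ℝ) : ℂ)) ^ (-s)
      = ((n : ℂ) + ((x + 1 / 2 : ℝ) : ℂ)) ^ (-s) := by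
    intro n
    have := hmul (n + (x + 1 / 2)) (by positivity)
    push_cast at this ⊢
    rw [← this]
    ring_nf
  have hse := summable_natCast_add_cpow_neg hx hs
  have hso := summable_natCast_add_cpow_neg (y := x + 1 / 2) (by positivity) hs
  rw [eq_sub_iff_add_eq', ← tsum_mul_left, ← tsum_even_add_odd
    (f := fun n : ℕ => (2 : ℂ) ^ s * ((n : ℂ) + ((2 * x : ℝ) : ℂ)) ^ (-s))
    (hse.congr fun n => (heven n).symm) (hso.congr fun n => (hodd n).symm)]
  simp only [heven, hodd]

/-- The second derivative of `c ^ s * f s - g s` at `s = 0`. -/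
lemma iteratedDeriv_two_cpow_mul_sub_zero {c : ℂ} (hc : c ≠ 0) {f g : ℂ → ℂ}
    (hf : ∀ᶠ s in 𝓝 0, DifferentiableAt ℂ f s) (hg : ∀ᶠ s in 𝓝 0, DifferentiableAt ℂ g s) :
    iteratedDeriv 2 (fun s => c ^ s * f s - g s) 0
      = Complex.log c ^ 2 * f 0 + 2 * Complex.log c * deriv f 0 + iteratedDeriv 2 f 0
        - iteratedDeriv 2 g 0 := by
  have hcd : ∀ s : ℂ, HasDerivAt (fun s : ℂ => c ^ s) (c ^ s * Complex.log c) s := fun s => by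
    simpa using (hasDerivAt_id s).const_cpow (Or.inl hc)
  have key : ∀ {k : ℂ → ℂ}, (∀ᶠ s in 𝓝 0, DifferentiableAt ℂ k s) →
      DifferentiableAt ℂ (deriv k) 0 := fun hk =>
    (Complex.analyticAt_iff_eventually_differentiableAt.2 hk).deriv.differentiableAt
  have h1 : deriv (fun s => c ^ s * f s - g s)
      =ᶠ[𝓝 0] fun s => c ^ s * Complex.log c * f s + c ^ s * deriv f s - deriv g s := by
    filter_upwards [hf, hg] with s hfs hgs
    exact (((hcd s).mul hfs.hasDerivAt).sub hgs.hasDerivAt).deriv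
  have h2 := ((((hcd 0).mul_const (Complex.log c)).mul hf.self_of_nhds.hasDerivAt).add
    ((hcd 0).mul (key hf).hasDerivAt)).sub (key hg).hasDerivAt
  simp only [iteratedDeriv_succ, iteratedDeriv_zero]
  rw [h1.deriv_eq]
  refine h2.deriv.trans ?_
  rw [Complex.cpow_zero]
  ring

/-- Let `H y` be the meromorphic continuation of the Hurwitz zeta
function `s ↦ ζ(s, y)` for each `y > 0` (differentiable away from `s = 1` and agreeing
with the Dirichlet series `∑ₙ (n + y)⁻ˢ` for `Re s > 1`). Then for all `x > 0`,
`ζ''(0, x + 1/2) = ζ''(0, 2x) - ζ''(0, x)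
  + 2 log 2 · (log Γ(2x) - (1/2) log(2π)) + log²2 · (1/2 - 2x)`. -/
theorem hurwitzZeta_second_deriv_zero_duplication
    (H : ℝ → ℂ → ℂ)
    (Hdiff : ∀ y : ℝ, 0 < y → ∀ s : ℂ, s ≠ 1 → DifferentiableAt ℂ (H y) s)
    (Hser : ∀ y : ℝ, 0 < y → ∀ s : ℂ, 1 < s.re →
      H y s = ∑' n : ℕ, ((n : ℂ) + (y : ℂ)) ^ (-s))
    (x : ℝ) (hx : 0 < x) :
    iteratedDeriv 2 (H (x + 1 / 2)) 0
      = iteratedDeriv 2 (H (2 * x)) 0 - iteratedDeriv 2 (H x) 0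
        + ((2 * Real.log 2 * (Real.log (Real.Gamma (2 * x)) - (1 / 2) * Real.log (2 * π))
            + (Real.log 2) ^ 2 * (1 / 2 - 2 * x) : ℝ) : ℂ) := by
  have hx2 : 0 < 2 * x := by positivity
  have hxh : 0 < x + 1 / 2 := by positivity
  have heq : Set.EqOn (H (x + 1 / 2)) (fun s => 2 ^ s * H (2 * x) s - H x s) hurwitzRegion := by
    refine eqOn_hurwitzRegion (fun s hs =>
      (Hdiff _ hxh s (ne_one_of_mem_hurwitzRegion hs)).differentiableWithinAt) (fun s hs => ?_) ?_
    · have h1 := Hdiff _ hx2 s (ne_one_of_mem_hurwitzRegion hs)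
      have h2 := Hdiff _ hx s (ne_one_of_mem_hurwitzRegion hs)
      exact DifferentiableAt.differentiableWithinAt (by fun_prop (disch := simp))
    · intro s _ hs1
      rw [Hser _ hxh s hs1, Hser _ hx2 s hs1, Hser _ hx s hs1,
        tsum_natCast_add_cpow_neg_add_half hx hs1]
  have hnhds := isOpen_hurwitzRegion.mem_nhds zero_mem_hurwitzRegion
  have hdiff : ∀ y : ℝ, 0 < y → ∀ᶠ s in 𝓝 (0 : ℂ), DifferentiableAt ℂ (H y) s := fun y hy => by
    filter_upwards [hnhds] with s hs using Hdiff y hy s (ne_one_of_mem_hurwitzRegion hs)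
  rw [(heq.eventuallyEq_of_mem hnhds).iteratedDeriv_eq 2,
    iteratedDeriv_two_cpow_mul_sub_zero two_ne_zero (hdiff _ hx2) (hdiff _ hx),
    hurwitz_continuation_apply_zero hx2 (Hdiff _ hx2) (Hser _ hx2),
    deriv_hurwitz_continuation_zero hx2 (Hdiff _ hx2) (Hser _ hx2),
    show Complex.log 2 = ((Real.log 2 : ℝ) : ℂ) by simp]
  push_cast
  ring
end

section
/- For 0 < t < 1, the s-derivative of the Hurwitz zeta function at s = −1 has the absolutely convergent Fourier expansion ζ'(−1, t) = (1/(4π)) ∑_{n=1}^∞ sin(2πnt)/n² − (1/(2π²))(γ + log(2π) − 1) ∑_{n=1}^∞ cos(2πnt)/n² − (1/(2π²)) ∑_{n=1}^∞ (log n) cos(2πnt)/n². -/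
open Real Complex Filter Topology HurwitzZeta

/-- The factor `2 (2π)^(-s) Γ(s)` of the functional equation of the Hurwitz zeta function,
differentiated at `2`. -/
lemma hasDerivAt_two_mul_two_pi_cpow_neg_mul_Gamma_two :
    HasDerivAt (fun s : ℂ => 2 * (2 * π : ℂ) ^ (-s) * Complex.Gamma s)
      (1 / (2 * π ^ 2) * (1 - Real.eulerMascheroniConstant - Real.log (2 * π))) 2 := by
  have hΓ : HasDerivAt Complex.Gamma (-Real.eulerMascheroniConstant + 1) 2 := by
    have h := Complex.hasDerivAt_Gamma_nat 1
    norm_num [harmonic] at h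
    exact h
  have hc := ((hasDerivAt_neg' (2 : ℂ)).const_cpow (c := 2 * π)
      (Or.inl (by exact_mod_cast Real.two_pi_pos.ne'))).const_mul 2
  refine (hc.mul hΓ).congr_deriv ?_
  have hπ : (π : ℂ) ≠ 0 := by exact_mod_cast Real.pi_ne_zero
  have hlog : Complex.log (2 * π) = (Real.log (2 * π) : ℂ) := by
    rw [Complex.ofReal_log (by positivity)]
    push_cast
    rfl
  have hpow : (2 * π : ℂ) ^ (-2 : ℂ) = 1 / (4 * π ^ 2) := by
    rw [Complex.cpow_neg, Complex.cpow_ofNat]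
    ring
  have hΓ2 : Complex.Gamma 2 = 1 := by simp
  rw [hlog, hpow, hΓ2]
  field_simp
  ring

/-- The functional equation of the Hurwitz zeta function in terms of the cosine and sine zeta
functions. -/
lemma hurwitzZeta_one_sub_eq_cosZeta_add_sinZeta (a : UnitAddCircle) {s : ℂ}
    (hs : ∀ n : ℕ, s ≠ -n) (hs' : a ≠ 0 ∨ s ≠ 1) :
    hurwitzZeta a (1 - s) = 2 * (2 * π : ℂ) ^ (-s) * Complex.Gamma s *
      (Complex.cos (π * s / 2) * cosZeta a s + Complex.sin (π * s / 2) * sinZeta a s) := by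
  rw [hurwitzZeta, hurwitzZetaEven_one_sub a hs hs', hurwitzZetaOdd_one_sub a hs]
  ring

/-- The derivative at `-1` of the Hurwitz zeta function, from its functional equation. -/
lemma deriv_hurwitzZeta_neg_one (a : UnitAddCircle) :
    deriv (hurwitzZeta a) (-1)
      = 1 / (4 * π) * sinZeta a 2
        - 1 / (2 * π ^ 2) * (Real.eulerMascheroniConstant + Real.log (2 * π) - 1) * cosZeta a 2
        + 1 / (2 * π ^ 2) * deriv (cosZeta a) 2 := by
  have hπ : (π : ℂ) ≠ 0 := by exact_mod_cast Real.pi_ne_zero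
  have hangle : HasDerivAt (fun s : ℂ => (π : ℂ) * s / 2) (π / 2) 2 := by
    simpa using ((hasDerivAt_id (2 : ℂ)).const_mul (π : ℂ)).div_const 2
  have hC : HasDerivAt (cosZeta a) (deriv (cosZeta a) 2) 2 :=
    (differentiableAt_cosZeta a (Or.inl (by norm_num))).hasDerivAt
  have hS : HasDerivAt (sinZeta a) (deriv (sinZeta a) 2) 2 :=
    (differentiableAt_sinZeta a).differentiableAt.hasDerivAt
  have hF := hasDerivAt_two_mul_two_pi_cpow_neg_mul_Gamma_two.mul
    ((hangle.ccos.mul hC).add (hangle.csin.mul hS))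
  have hH : HasDerivAt (hurwitzZeta a) (deriv (hurwitzZeta a) (-1)) (1 - 2) := by
    rw [show (1 - 2 : ℂ) = -1 by norm_num]
    exact (differentiableAt_hurwitzZeta a (by norm_num)).hasDerivAt
  have hG := hH.comp (2 : ℂ) ((hasDerivAt_id (2 : ℂ)).const_sub 1)
  have hnhds : {s : ℂ | 1 < s.re} ∈ 𝓝 (2 : ℂ) :=
    (isOpen_lt continuous_const Complex.continuous_re).mem_nhds (by simp)
  have hGF := hG.unique (hF.congr_of_eventuallyEq (by
    filter_upwards [hnhds] with s hs
    refine hurwitzZeta_one_sub_eq_cosZeta_add_sinZeta a (fun n hn => ?_) (Or.inr fun h => ?_)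
    · have : (0 : ℝ) ≤ n := n.cast_nonneg
      simp only [hn, Complex.neg_re, Complex.natCast_re] at hs
      linarith
    · simp [h] at hs))
  have hpow : (2 * π : ℂ) ^ (-2 : ℂ) = 1 / (4 * π ^ 2) := by
    rw [Complex.cpow_neg, Complex.cpow_ofNat]
    ring
  have hΓ2 : Complex.Gamma 2 = 1 := by simp
  simp only [mul_div_cancel_right₀ (π : ℂ) (two_ne_zero), Complex.cos_pi, Complex.sin_pi, hpow,
    hΓ2, Pi.add_apply, Pi.mul_apply] at hGF
  rw [mul_neg_one] at hGF
  rw [← neg_neg (deriv (hurwitzZeta a) (-1)), hGF]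
  field_simp
  ring

/-- The negated derivative of the cosine zeta function as a Dirichlet series. -/
lemma hasSum_nat_neg_deriv_cosZeta (a : ℝ) {s : ℂ} (hs : 1 < s.re) :
    HasSum (fun n : ℕ => Complex.log n * Real.cos (2 * π * a * n) / (n : ℂ) ^ s)
      (-deriv (cosZeta a) s) := by
  have habs : LSeries.abscissaOfAbsConv (fun n : ℕ => (Real.cos (2 * π * a * n) : ℂ)) < s.re := by
    refine lt_of_le_of_lt (LSeries.abscissaOfAbsConv_le_of_forall_lt_LSeriesSummable (x := 1)
      fun y hy => (LSeriesHasSum_cos a (s := y) (by simpa using hy)).LSeriesSummable) ?_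
    exact_mod_cast hs
  have heq : cosZeta a =ᶠ[𝓝 s] LSeries (fun n : ℕ => (Real.cos (2 * π * a * n) : ℂ)) := by
    filter_upwards [(isOpen_lt continuous_const Complex.continuous_re).mem_nhds hs] with z hz
    exact (LSeriesHasSum_cos a hz).LSeries_eq.symm
  rw [heq.deriv_eq, LSeries_deriv habs, neg_neg]
  exact (LSeriesSummable_logMul_of_lt_re habs).LSeriesHasSum.congr_fun
    fun n => (LSeries.term_of_ne_zero' (Complex.ne_zero_of_one_lt_re hs)
      (LSeries.logMul fun n : ℕ => (Real.cos (2 * π * a * n) : ℂ)) n).symm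

/-- A Dirichlet series at `2` with real coefficients, reindexed to start at `n = 0`. -/
lemma hasSum_ofReal_div_succ_sq {f : ℕ → ℝ} {c : ℂ}
    (h : HasSum (fun n : ℕ => (f n : ℂ) / (n : ℂ) ^ (2 : ℂ)) c) :
    HasSum (fun n : ℕ => ((f (n + 1) / (n + 1) ^ 2 : ℝ) : ℂ)) c := by
  have h' := (hasSum_nat_add_iff' 1).mpr h
  simpa using h'

/-- For `0 < t < 1`, the `s`-derivative of the Hurwitz zeta function at
`s = -1` has the absolutely convergent Fourier expansion
`ζ'(-1, t) = (1/(4π)) ∑ₙ sin(2πnt)/n² - (1/(2π²))(γ + log(2π) - 1) ∑ₙ cos(2πnt)/n²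
  - (1/(2π²)) ∑ₙ (log n) cos(2πnt)/n²`. -/
theorem hurwitzZeta_deriv_neg_one_fourier (t : ℝ) (ht0 : 0 < t) (ht1 : t < 1) :
    Summable (fun n : ℕ => Real.sin (2 * π * (n + 1) * t) / (n + 1) ^ 2)
    ∧ Summable (fun n : ℕ => Real.cos (2 * π * (n + 1) * t) / (n + 1) ^ 2)
    ∧ Summable (fun n : ℕ => Real.log (n + 1) * Real.cos (2 * π * (n + 1) * t) / (n + 1) ^ 2)
    ∧ deriv (fun s : ℂ => hurwitzZeta (t : UnitAddCircle) s) (-1)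
        = (((1 / (4 * π)) * ∑' n : ℕ, Real.sin (2 * π * (n + 1) * t) / (n + 1) ^ 2
            - (1 / (2 * π ^ 2)) * (Real.eulerMascheroniConstant + Real.log (2 * π) - 1)
              * ∑' n : ℕ, Real.cos (2 * π * (n + 1) * t) / (n + 1) ^ 2
            - (1 / (2 * π ^ 2))
              * ∑' n : ℕ, Real.log (n + 1) * Real.cos (2 * π * (n + 1) * t) / (n + 1) ^ 2
            : ℝ) : ℂ) := by
  have h2 : 1 < (2 : ℂ).re := by simp
  have hS := hasSum_ofReal_div_succ_sq (hasSum_nat_sinZeta t h2)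
  have hC := hasSum_ofReal_div_succ_sq (hasSum_nat_cosZeta t h2)
  have hL := hasSum_ofReal_div_succ_sq
    (f := fun n => Real.log n * Real.cos (2 * π * t * n))
    ((hasSum_nat_neg_deriv_cosZeta t h2).congr_fun fun n => by simp [Complex.ofReal_log])
  simp only [Nat.cast_add, Nat.cast_one, mul_right_comm _ t] at hS hC hL
  refine ⟨Complex.summable_ofReal.mp hS.summable, Complex.summable_ofReal.mp hC.summable,
    Complex.summable_ofReal.mp hL.summable, ?_⟩
  have hd := neg_eq_iff_eq_neg.mp hL.tsum_eq.symm
  rw [deriv_hurwitzZeta_neg_one, ← hS.tsum_eq, ← hC.tsum_eq, hd, ← Complex.ofReal_tsum,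
    ← Complex.ofReal_tsum, ← Complex.ofReal_tsum]
  push_cast
  ring
end

section
/- log G(1/2) = (1/24) log 2 − (1/4) log π + (3/2) ζ'(−1), where G is the Barnes double gamma function (so G(1/2) = G(3/2)/Γ(1/2)) and ζ'(−1) denotes the derivative of the Riemann zeta function at −1. -/
open Real Complex Filter Topology

/-- `log G(1+x)` for the Barnes double gamma function `G`, given for `x > -1` by the
convergent expansion
`log G(1+x) = (x/2) log(2π) - x(1+x)/2 - γx²/2 + ∑ₙ [x²/(2n) - x + n log(1 + x/n)]`. -/
noncomputable def logBarnesG1p (x : ℝ) : ℝ :=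
  x / 2 * Real.log (2 * π) - x * (1 + x) / 2
    - Real.eulerMascheroniConstant * x ^ 2 / 2
    + ∑' n : ℕ, (x ^ 2 / (2 * (n + 1)) - x + (n + 1) * Real.log (1 + x / (n + 1)))

/-- The third finite difference of `n ↦ n ^ (-s)`, with alternating sign. -/
noncomputable def altDiffTerm (k : ℕ) (s : ℂ) : ℂ :=
  (-1) ^ k * ((k + 1 : ℂ) ^ (-s) - 3 * (k + 2 : ℂ) ^ (-s) + 3 * (k + 3 : ℂ) ^ (-s)
    - (k + 4 : ℂ) ^ (-s))

lemma norm_forward_diff_le {g g' : ℝ → ℂ} {a C : ℝ}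
    (hg : ∀ y, a ≤ y → HasDerivAt g (g' y) y) (hC : ∀ y, a ≤ y → ‖g' y‖ ≤ C)
    (y : ℝ) (hy : a ≤ y) : ‖g (y + 1) - g y‖ ≤ C := by
  have h := norm_image_sub_le_of_norm_deriv_le_segment' (f := g) (f' := g') (a := y)
    (b := y + 1) (C := C) (fun x hx => (hg x (hy.trans hx.1)).hasDerivWithinAt)
    (fun x hx => hC x (hy.trans hx.1)) (y + 1) ⟨by linarith, le_rfl⟩
  simpa using h

lemma norm_third_forward_diff_le {g₀ g₁ g₂ g₃ : ℝ → ℂ} {a C : ℝ}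
    (h₀ : ∀ y, a ≤ y → HasDerivAt g₀ (g₁ y) y) (h₁ : ∀ y, a ≤ y → HasDerivAt g₁ (g₂ y) y)
    (h₂ : ∀ y, a ≤ y → HasDerivAt g₂ (g₃ y) y) (hC : ∀ y, a ≤ y → ‖g₃ y‖ ≤ C) :
    ‖g₀ a - 3 * g₀ (a + 1) + 3 * g₀ (a + 2) - g₀ (a + 3)‖ ≤ C := by
  have hdiff : ∀ {g g' : ℝ → ℂ}, (∀ y, a ≤ y → HasDerivAt g (g' y) y) →
      ∀ y, a ≤ y → HasDerivAt (fun y => g (y + 1) - g y) (g' (y + 1) - g' y) y :=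
    fun hg y hy => ((hg (y + 1) (by linarith)).comp_add_const y 1).sub (hg y hy)
  have k := norm_forward_diff_le (hdiff (hdiff h₀))
    (norm_forward_diff_le (hdiff h₁) (norm_forward_diff_le h₂ hC)) a le_rfl
  rw [← norm_neg]
  refine (le_of_eq (congrArg _ ?_)).trans k
  rw [show a + 1 + 1 + 1 = a + 3 by ring, show a + 1 + 1 = a + 2 by ring]
  ring

lemma hasDerivAt_ofReal_cpow_of_pos (r : ℂ) {y : ℝ} (hy : 0 < y) :
    HasDerivAt (fun y : ℝ => (y : ℂ) ^ r) (r * (y : ℂ) ^ (r - 1)) y := by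
  simpa using ((hasDerivAt_id (y : ℂ)).cpow_const (c := r)
    (Or.inl (by simpa using hy))).comp_ofReal

lemma norm_third_diff_cpow_le {r : ℂ} (hr : r.re ≤ 3) {a : ℝ} (ha : 0 < a) :
    ‖(a : ℂ) ^ r - 3 * ((a + 1 : ℝ) : ℂ) ^ r + 3 * ((a + 2 : ℝ) : ℂ) ^ r
      - ((a + 3 : ℝ) : ℂ) ^ r‖ ≤ ‖r * (r - 1) * (r - 2)‖ * a ^ (r.re - 3) := by
  refine norm_third_forward_diff_le (g₀ := fun y : ℝ => (y : ℂ) ^ r)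
    (g₁ := fun y : ℝ => r * (y : ℂ) ^ (r - 1))
    (g₂ := fun y : ℝ => r * ((r - 1) * (y : ℂ) ^ (r - 1 - 1)))
    (g₃ := fun y : ℝ => r * ((r - 1) * ((r - 1 - 1) * (y : ℂ) ^ (r - 1 - 1 - 1))))
    (fun y hy => hasDerivAt_ofReal_cpow_of_pos r (ha.trans_le hy))
    (fun y hy => (hasDerivAt_ofReal_cpow_of_pos _ (ha.trans_le hy)).const_mul _)
    (fun y hy => ((hasDerivAt_ofReal_cpow_of_pos _ (ha.trans_le hy)).const_mul _).const_mul _)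
    (fun y hy => ?_)
  rw [show r * ((r - 1) * ((r - 1 - 1) * (y : ℂ) ^ (r - 1 - 1 - 1)))
    = r * (r - 1) * (r - 2) * (y : ℂ) ^ (r - 3) by ring_nf, norm_mul,
    norm_cpow_eq_rpow_re_of_pos (ha.trans_le hy)]
  gcongr
  simpa using Real.rpow_le_rpow_of_nonpos ha hy (by linarith : r.re - 3 ≤ 0)

lemma norm_altDiffTerm_le (k : ℕ) {s : ℂ} (hs : s ∈ Metric.ball (1 : ℂ) (9 / 4)) :
    ‖altDiffTerm k s‖ ≤ 120 * ((k + 1 : ℕ) : ℝ) ^ (-(7 / 4) : ℝ) := by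
  rw [mem_ball_iff_norm] at hs
  have hre : -(5 / 4) < s.re := by
    have := (abs_le.1 (Complex.abs_re_le_norm (s - 1))).1
    simp only [sub_re, one_re] at this
    linarith
  have hk : (1 : ℝ) ≤ ((k + 1 : ℕ) : ℝ) := by simp
  have h := norm_third_diff_cpow_le (r := -s) (a := ((k + 1 : ℕ) : ℝ))
    (by simp only [neg_re]; linarith) (by positivity)
  have e : ‖altDiffTerm k s‖ = ‖(((k + 1 : ℕ) : ℝ) : ℂ) ^ (-s)
      - 3 * ((((k + 1 : ℕ) : ℝ) + 1 : ℝ) : ℂ) ^ (-s)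
      + 3 * ((((k + 1 : ℕ) : ℝ) + 2 : ℝ) : ℂ) ^ (-s)
      - ((((k + 1 : ℕ) : ℝ) + 3 : ℝ) : ℂ) ^ (-s)‖ := by
    rw [altDiffTerm, norm_mul, norm_pow, norm_neg, norm_one, one_pow, one_mul]
    push_cast
    ring_nf
  rw [e]
  refine h.trans ?_
  have n0 : ‖-s‖ ≤ 4 := by
    rw [show -s = -(s - 1) - 1 by ring]
    refine (norm_sub_le _ _).trans ?_
    rw [norm_neg, norm_one]
    linarith
  have n1 : ‖-s - 1‖ ≤ 5 := (norm_sub_le _ _).trans (by simp at n0 ⊢; linarith)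
  have n2 : ‖-s - 2‖ ≤ 6 := (norm_sub_le _ _).trans (by simp at n0 ⊢; linarith)
  have n : ‖-s * (-s - 1) * (-s - 2)‖ ≤ 120 := by
    rw [norm_mul, norm_mul]
    calc _ ≤ (4 : ℝ) * 5 * 6 := by gcongr
      _ = 120 := by norm_num
  gcongr
  simp only [neg_re]
  linarith

lemma summable_altDiffTerm_bound :
    Summable fun k : ℕ => 120 * ((k + 1 : ℕ) : ℝ) ^ (-(7 / 4) : ℝ) :=
  (((summable_nat_add_iff 1).2 (Real.summable_nat_rpow.2 (by norm_num)))).mul_left 120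

lemma hasDerivAt_natCast_cpow_neg (n : ℕ) (hn : n ≠ 0) (s : ℂ) :
    HasDerivAt (fun s : ℂ => (n : ℂ) ^ (-s)) (-((n : ℂ) ^ (-s) * Real.log n)) s := by
  have h := (hasDerivAt_neg s).const_cpow (c := (n : ℂ)) (Or.inl (by exact_mod_cast hn))
  rw [Complex.natCast_log]
  simpa using h

lemma hasDerivAt_altDiffTerm (k : ℕ) (s : ℂ) :
    HasDerivAt (altDiffTerm k)
      ((-1) ^ k * (-((k + 1 : ℂ) ^ (-s) * Real.log (k + 1))
        + 3 * ((k + 2 : ℂ) ^ (-s) * Real.log (k + 2))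
        - 3 * ((k + 3 : ℂ) ^ (-s) * Real.log (k + 3))
        + (k + 4 : ℂ) ^ (-s) * Real.log (k + 4))) s := by
  have h := (((((hasDerivAt_natCast_cpow_neg (k + 1) (by simp) s).sub
    ((hasDerivAt_natCast_cpow_neg (k + 2) (by simp) s).const_mul 3)).add
    ((hasDerivAt_natCast_cpow_neg (k + 3) (by simp) s).const_mul 3)).sub
    (hasDerivAt_natCast_cpow_neg (k + 4) (by simp) s))).const_mul ((-1) ^ k)
  push_cast at h
  refine h.congr_deriv ?_
  ring

/-- Sign-alternating form of the Dirichlet series for `(1 - 2 ^ (1 - s)) ζ(s)`. -/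
lemma hasSum_dirichletEta {s : ℂ} (hs : 1 < s.re) :
    HasSum (fun k : ℕ => (-1) ^ k * (k + 1 : ℂ) ^ (-s)) ((1 - 2 ^ (1 - s)) * riemannZeta s) := by
  have hsum : HasSum (fun k : ℕ => (k + 1 : ℂ) ^ (-s)) (riemannZeta s) := by
    rw [zeta_eq_tsum_one_div_nat_add_one_cpow hs]
    have : Summable fun k : ℕ => 1 / (k + 1 : ℂ) ^ s := by
      exact_mod_cast (summable_nat_add_iff 1).2 (Complex.summable_one_div_nat_cpow.2 hs)
    simpa only [one_div, ← Complex.cpow_neg] using this.hasSum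
  have hodd : HasSum (fun k : ℕ => ((2 * k + 1 : ℕ) + 1 : ℂ) ^ (-s))
      (2 ^ (-s) * riemannZeta s) := by
    have e := hsum.mul_left ((2 : ℂ) ^ (-s))
    refine (congrArg (HasSum · _) (funext fun k => ?_)).mp e
    have := Complex.natCast_mul_natCast_cpow 2 (k + 1) (-s)
    push_cast at this ⊢
    rw [← this]
    ring_nf
  have heven : HasSum (fun k : ℕ => ((2 * k : ℕ) + 1 : ℂ) ^ (-s))
      (riemannZeta s - 2 ^ (-s) * riemannZeta s) := by
    have h : Summable fun k : ℕ => ((2 * k : ℕ) + 1 : ℂ) ^ (-s) :=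
      hsum.summable.comp_injective (i := fun k => 2 * k) fun a b h => by simpa using h
    have := (h.hasSum.even_add_odd (f := fun k : ℕ => (k + 1 : ℂ) ^ (-s)) hodd).unique hsum
    rw [← eq_sub_iff_add_eq.2 this]
    exact h.hasSum
  have h := HasSum.even_add_odd (f := fun k : ℕ => (-1) ^ k * (k + 1 : ℂ) ^ (-s))
    (m := riemannZeta s - 2 ^ (-s) * riemannZeta s) (m' := -(2 ^ (-s) * riemannZeta s))
    (by simpa [pow_mul] using heven) (by simpa [pow_mul, pow_succ] using hodd.neg)
  convert h using 1
  rw [sub_eq_add_neg 1 s, Complex.cpow_add _ _ two_ne_zero, Complex.cpow_one]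
  ring

lemma tsum_altDiffTerm {s : ℂ} (hs : 1 < s.re) :
    ∑' k, altDiffTerm k s
      = 8 * ((1 - 2 ^ (1 - s)) * riemannZeta s) - 7 + 4 * 2 ^ (-s) - 3 ^ (-s) := by
  have h0 := hasSum_dirichletEta hs
  have hshift := fun m : ℕ => (hasSum_nat_add_iff' m).2 h0
  have h := ((h0.add ((hshift 1).mul_left 3)).add ((hshift 2).mul_left 3)).add (hshift 3)
  convert h.tsum_eq using 1
  · refine tsum_congr fun k => ?_
    simp only [altDiffTerm]
    push_cast
    ring_nf
  · simp [Finset.sum_range_succ]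
    ring_nf

lemma riemannZeta₁_mul_eq_tsum_altDiffTerm {s : ℂ} (hs : s ∈ Metric.ball (1 : ℂ) (9 / 4)) :
    8 * ((1 - 2 ^ (1 - s)) * riemannZeta₁ s)
      = (s - 1) * (∑' k, altDiffTerm k s + 7 - 4 * 2 ^ (-s) + 3 ^ (-s)) := by
  have hT : DifferentiableOn ℂ (fun s => ∑' k, altDiffTerm k s) (Metric.ball (1 : ℂ) (9 / 4)) :=
    Complex.differentiableOn_tsum_of_summable_norm summable_altDiffTerm_bound
      (fun k s _ => (hasDerivAt_altDiffTerm k s).differentiableAt.differentiableWithinAt)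
      Metric.isOpen_ball fun k s hs => norm_altDiffTerm_le k hs
  have hc : ∀ c : ℂ, c ≠ 0 → ∀ f : ℂ → ℂ, Differentiable ℂ f →
      Differentiable ℂ fun s => c ^ f s := fun c hc f hf => hf.const_cpow (Or.inl hc)
  refine AnalyticOnNhd.eqOn_of_preconnected_of_eventuallyEq
    (f := fun s => 8 * ((1 - 2 ^ (1 - s)) * riemannZeta₁ s))
    (g := fun s => (s - 1) * (∑' k, altDiffTerm k s + 7 - 4 * 2 ^ (-s) + 3 ^ (-s))) (z₀ := 2)
    (DifferentiableOn.analyticOnNhd ?_ Metric.isOpen_ball)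
    (DifferentiableOn.analyticOnNhd ?_ Metric.isOpen_ball)
    (convex_ball _ _).isPreconnected ?_ ?_ hs
  · have h2 := hc 2 two_ne_zero (fun s => 1 - s) (by fun_prop)
    have h1 := differentiable_riemannZeta₁
    exact (((h2.const_sub 1).mul h1).const_mul 8).differentiableOn
  · have h2 := hc 2 two_ne_zero (fun s => -s) (by fun_prop)
    have h3 := hc 3 three_ne_zero (fun s => -s) (by fun_prop)
    exact (differentiable_id.sub_const 1).differentiableOn.mul
      (((hT.add_const 7).sub (h2.const_mul 4).differentiableOn).add h3.differentiableOn)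
  · rw [mem_ball_iff_norm]; norm_num
  · filter_upwards [(isOpen_lt continuous_const Complex.continuous_re).mem_nhds
      (show (1 : ℝ) < (2 : ℂ).re by simp)] with s hs
    have hs1 : s ≠ 1 := fun h => by simp [h] at hs
    have hs1' : s - 1 ≠ 0 := sub_ne_zero.2 hs1
    rw [tsum_altDiffTerm hs, riemannZeta_eq_inv_sub_mul hs1]
    field_simp
    ring

lemma deriv_tsum_altDiffTerm :
    deriv (fun s => ∑' k, altDiffTerm k s) (-1)
      = -(24 * deriv riemannZeta (-1)) - 32 / 3 * Real.log 2 + 3 * Real.log 3 := by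
  have hm : (-1 : ℂ) ∈ Metric.ball (1 : ℂ) (9 / 4) := by
    rw [mem_ball_iff_norm]; norm_num
  have h1 : (-1 : ℂ) ≠ 1 := by norm_num
  have heq : (fun s => ∑' k, altDiffTerm k s) =ᶠ[𝓝 (-1)] fun s =>
      8 * ((1 - 2 ^ (1 - s)) * riemannZeta s) - 7 + 4 * ((2 : ℕ) : ℂ) ^ (-s)
        - ((3 : ℕ) : ℂ) ^ (-s) := by
    filter_upwards [Metric.isOpen_ball.mem_nhds hm, isOpen_ne.mem_nhds h1] with s hs hs1
    have hs1' : s - 1 ≠ 0 := sub_ne_zero.2 hs1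
    have h := riemannZeta₁_mul_eq_tsum_altDiffTerm hs
    rw [riemannZeta_eq_inv_sub_mul hs1]
    push_cast
    field_simp
    linear_combination -h
  have hz : riemannZeta (-1) = -1 / 12 := by
    have := riemannZeta_neg_nat_eq_bernoulli 1
    norm_num [bernoulli_two] at this
    rw [this]; norm_num
  have hpow : HasDerivAt (fun s : ℂ => (2 : ℂ) ^ (1 - s)) (-(4 * Real.log 2)) (-1) := by
    have h := ((hasDerivAt_id (-1 : ℂ)).const_sub 1).const_cpow (c := (2 : ℂ)) (Or.inl two_ne_zero)
    refine h.congr_deriv ?_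
    rw [Complex.ofReal_log zero_le_two]
    norm_num
  have h := ((((((hpow.const_sub 1).mul (differentiableAt_riemannZeta h1).hasDerivAt).const_mul
    8).sub_const 7).add ((hasDerivAt_natCast_cpow_neg 2 two_ne_zero (-1)).const_mul 4)).sub
    (hasDerivAt_natCast_cpow_neg 3 three_ne_zero (-1)))
  rw [heq.deriv_eq]
  refine h.deriv.trans ?_
  rw [hz]
  norm_num
  ring

lemma exists_hasSum_altDiff_mul_log : ∃ D : ℝ,
    (D : ℂ) = -(24 * deriv riemannZeta (-1)) - 32 / 3 * Real.log 2 + 3 * Real.log 3 ∧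
    HasSum (fun k : ℕ => (-1) ^ k * (-(((k + 1 : ℕ) : ℝ) * Real.log (k + 1 : ℕ))
      + 3 * (((k + 2 : ℕ) : ℝ) * Real.log (k + 2 : ℕ))
      - 3 * (((k + 3 : ℕ) : ℝ) * Real.log (k + 3 : ℕ))
      + ((k + 4 : ℕ) : ℝ) * Real.log (k + 4 : ℕ))) D := by
  have h := Complex.hasSum_deriv_of_summable_norm summable_altDiffTerm_bound
    (fun k s _ => (hasDerivAt_altDiffTerm k s).differentiableAt.differentiableWithinAt)
    Metric.isOpen_ball (fun k s hs => norm_altDiffTerm_le k hs)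
    (show (-1 : ℂ) ∈ Metric.ball (1 : ℂ) (9 / 4) by rw [mem_ball_iff_norm]; norm_num)
  rw [deriv_tsum_altDiffTerm] at h
  have e : (fun k : ℕ => deriv (altDiffTerm k) (-1)) = fun k : ℕ =>
      (((-1) ^ k * (-(((k + 1 : ℕ) : ℝ) * Real.log (k + 1 : ℕ))
      + 3 * (((k + 2 : ℕ) : ℝ) * Real.log (k + 2 : ℕ))
      - 3 * (((k + 3 : ℕ) : ℝ) * Real.log (k + 3 : ℕ))
      + ((k + 4 : ℕ) : ℝ) * Real.log (k + 4 : ℕ)) : ℝ) : ℂ) := by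
    funext k
    rw [(hasDerivAt_altDiffTerm k (-1)).deriv]
    push_cast
    simp
  rw [e] at h
  have him := (Complex.hasSum_iff _ _).1 h
  simp only [Complex.ofReal_re, Complex.ofReal_im] at him
  exact ⟨_, Complex.ext rfl (by simpa using hasSum_zero.unique him.2), him.1⟩

lemma sum_range_altDiff (L : ℕ → ℝ) (N : ℕ) :
    ∑ k ∈ Finset.range (2 * N), (-1) ^ k * (-L (k + 1) + 3 * L (k + 2) - 3 * L (k + 3) + L (k + 4))
      = -(8 * ∑ n ∈ Finset.range N, (L (2 * n + 1) - L (2 * n + 2))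
        + 7 * L (2 * N + 1) - 4 * L (2 * N + 2) + L (2 * N + 3)) + 7 * L 1 - 4 * L 2 + L 3 := by
  induction N with
  | zero => simp; ring
  | succ N ih =>
    rw [show 2 * (N + 1) = 2 * N + 1 + 1 by ring, Finset.sum_range_succ, Finset.sum_range_succ, ih,
      Finset.sum_range_succ, pow_succ, pow_mul]
    simp only [add_assoc, Nat.reduceAdd]
    norm_num
    ring

lemma sum_range_barnes_half (N : ℕ) :
    ∑ n ∈ Finset.range N, ((1 / 2 : ℝ) ^ 2 / (2 * (n + 1)) - 1 / 2
        + (n + 1) * Real.log (1 + 1 / 2 / (n + 1)))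
      = (harmonic N : ℝ) / 8 - N / 2
        + (∑ n ∈ Finset.range N, (((2 * n + 1 : ℕ) : ℝ) * Real.log (2 * n + 1 : ℕ)
          - ((2 * n + 2 : ℕ) : ℝ) * Real.log (2 * n + 2 : ℕ))) / 2
        + N * Real.log (2 * N + 1)
        - (Real.log (2 * N).factorial - N * Real.log 2 - Real.log N.factorial) / 2 := by
  induction N with
  | zero => simp
  | succ N ih =>
    have hN : (N : ℝ) + 1 ≠ 0 := by positivity
    have e1 : Real.log (1 + 1 / 2 / ((N : ℝ) + 1))
        = Real.log (2 * N + 3) - Real.log 2 - Real.log (N + 1) := by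
      rw [sub_sub, ← Real.log_mul two_ne_zero hN, ← Real.log_div (by positivity) (by positivity)]
      congr 1
      field_simp
      ring
    have e2 : Real.log (N + 1).factorial = Real.log (N + 1) + Real.log N.factorial := by
      rw [Nat.factorial_succ, Nat.cast_mul, Real.log_mul (by positivity) (by positivity)]
      push_cast
      rfl
    have e3 : Real.log (2 * N + 2 : ℝ) = Real.log 2 + Real.log (N + 1) := by
      rw [← Real.log_mul two_ne_zero hN]
      ring_nf
    have e4 : Real.log (2 * (N + 1)).factorial
        = Real.log (2 * N + 2) + Real.log (2 * N + 1) + Real.log (2 * N).factorial := by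
      rw [show 2 * (N + 1) = 2 * N + 1 + 1 by ring, Nat.factorial_succ, Nat.factorial_succ,
        Nat.cast_mul, Nat.cast_mul, Real.log_mul (by positivity) (by positivity),
        Real.log_mul (by positivity) (by positivity)]
      push_cast
      ring_nf
    rw [Finset.sum_range_succ, Finset.sum_range_succ, ih, harmonic_succ, e1, e2, e4]
    push_cast
    rw [show (2 * ((N : ℝ) + 1) + 1) = 2 * N + 3 by ring, e3]
    field_simp
    ring

lemma tendsto_log_stirlingSeq :
    Tendsto (fun n => Real.log (Stirling.stirlingSeq n)) atTop (𝓝 (Real.log √π)) :=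
  Stirling.tendsto_stirlingSeq_sqrt_pi.log (by positivity)

lemma sum_range_barnes_half_eq {N : ℕ} (hN : N ≠ 0) :
    ∑ n ∈ Finset.range N, ((1 / 2 : ℝ) ^ 2 / (2 * (n + 1)) - 1 / 2
        + (n + 1) * Real.log (1 + 1 / 2 / (n + 1)))
      = ((harmonic N : ℝ) - Real.log N) / 8
        + (8 * ∑ n ∈ Finset.range N, (((2 * n + 1 : ℕ) : ℝ) * Real.log (2 * n + 1 : ℕ)
            - ((2 * n + 2 : ℕ) : ℝ) * Real.log (2 * n + 2 : ℕ))
          + 7 * (((2 * N + 1 : ℕ) : ℝ) * Real.log (2 * N + 1 : ℕ))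
          - 4 * (((2 * N + 2 : ℕ) : ℝ) * Real.log (2 * N + 2 : ℕ))
          + ((2 * N + 3 : ℕ) : ℝ) * Real.log (2 * N + 3 : ℕ)) / 16
        - Real.log (Stirling.stirlingSeq (2 * N)) / 2 + Real.log (Stirling.stirlingSeq N) / 2
        + (-(3 / 8) * Real.log 2 + N * Real.log (1 + 1 / 2 / N)
          - (14 * (N * Real.log (1 + 1 / 2 / N)) + 7 * Real.log (1 + 1 / 2 / N)
            - 8 * (N * Real.log (1 + 1 / N)) - 8 * Real.log (1 + 1 / N)
            + 2 * (N * Real.log (1 + 3 / 2 / N)) + 3 * Real.log (1 + 3 / 2 / N)) / 16) := by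
  have hN' : (N : ℝ) ≠ 0 := by exact_mod_cast hN
  have hpos : (0 : ℝ) < N := by positivity
  have hlog : ∀ j t : ℝ, 0 ≤ j → t = j / 2 → Real.log (1 + t / N)
      = Real.log (2 * N + j) - Real.log 2 - Real.log N := fun j t hj ht => by
    rw [sub_sub, ← Real.log_mul two_ne_zero hN', ← Real.log_div (by positivity) (by positivity), ht]
    congr 1
    field_simp
  rw [sum_range_barnes_half, Stirling.log_stirlingSeq_formula, Stirling.log_stirlingSeq_formula,
    hlog 1 (1 / 2) (by norm_num) (by norm_num), hlog 2 1 (by norm_num) (by norm_num),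
    hlog 3 (3 / 2) (by norm_num) (by norm_num)]
  push_cast
  rw [Real.log_div (by positivity) (by positivity), Real.log_div (by positivity) (by positivity),
    Real.log_exp, Real.log_mul (by positivity) (by positivity),
    Real.log_mul (by positivity) (by positivity)]
  ring

lemma hasSum_barnes_half {D : ℝ}
    (hD : HasSum (fun k : ℕ => (-1) ^ k * (-(((k + 1 : ℕ) : ℝ) * Real.log (k + 1 : ℕ))
      + 3 * (((k + 2 : ℕ) : ℝ) * Real.log (k + 2 : ℕ))
      - 3 * (((k + 3 : ℕ) : ℝ) * Real.log (k + 3 : ℕ))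
      + ((k + 4 : ℕ) : ℝ) * Real.log (k + 4 : ℕ))) D) :
    HasSum (fun n : ℕ => (1 / 2 : ℝ) ^ 2 / (2 * (n + 1)) - 1 / 2
        + (n + 1) * Real.log (1 + 1 / 2 / (n + 1)))
      (Real.eulerMascheroniConstant / 8 + (-D - 8 * Real.log 2 + 3 * Real.log 3) / 16
        - 3 / 8 * Real.log 2 + 3 / 8) := by
  rw [hasSum_iff_tendsto_nat_of_nonneg]
  · have hdouble : Tendsto (fun N : ℕ => 2 * N) atTop atTop :=
      tendsto_id.const_mul_atTop' two_pos
    have hB := hD.tendsto_sum_nat.comp hdouble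
    have hmul : ∀ t : ℝ, Tendsto (fun N : ℕ => (N : ℝ) * Real.log (1 + t / N)) atTop (𝓝 t) :=
      fun t => (Real.tendsto_mul_log_one_add_div_atTop t).comp tendsto_natCast_atTop_atTop
    have hlog : ∀ t : ℝ, Tendsto (fun N : ℕ => Real.log (1 + t / N)) atTop (𝓝 0) := fun t => by
      simpa using ((tendsto_const_div_atTop_nhds_zero_nat t).const_add 1).log (by simp)
    have hB' := ((hB.neg.sub_const (8 * Real.log 2)).add_const (3 * Real.log 3)).div_const 16
    have hR := ((hmul (1 / 2)).const_add (-(3 / 8) * Real.log 2)).sub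
      ((((((((hmul (1 / 2)).const_mul 14).add ((hlog (1 / 2)).const_mul 7)).sub
        ((hmul 1).const_mul 8)).sub ((hlog 1).const_mul 8)).add
        ((hmul (3 / 2)).const_mul 2)).add ((hlog (3 / 2)).const_mul 3)).div_const 16)
    have h := ((((Real.tendsto_harmonic_sub_log.div_const 8).add hB').sub
      ((tendsto_log_stirlingSeq.comp hdouble).div_const 2)).add
      (tendsto_log_stirlingSeq.div_const 2)).add hR
    refine (h.congr' ?_).trans (le_of_eq (congrArg 𝓝 (by ring)))
    filter_upwards [eventually_ne_atTop 0] with N hN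
    rw [sum_range_barnes_half_eq hN]
    simp only [Function.comp_apply]
    rw [sum_range_altDiff fun n : ℕ => (n : ℝ) * Real.log n]
    norm_num
    ring
  · intro n
    have h := Real.le_log_one_add_of_nonneg (x := 1 / 2 / ((n : ℝ) + 1)) (by positivity)
    have h' := mul_le_mul_of_nonneg_left h (by positivity : (0 : ℝ) ≤ n + 1)
    have : 0 ≤ (1 / 2 : ℝ) ^ 2 / (2 * (n + 1)) - 1 / 2
        + (n + 1) * (2 * (1 / 2 / ((n : ℝ) + 1)) / (1 / 2 / ((n : ℝ) + 1) + 2)) := by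
      have e : (1 / 2 : ℝ) ^ 2 / (2 * (n + 1)) - 1 / 2
        + (n + 1) * (2 * (1 / 2 / ((n : ℝ) + 1)) / (1 / 2 / ((n : ℝ) + 1) + 2))
          = 1 / (8 * (n + 1) * (4 * n + 5)) := by
        field_simp
        ring
      rw [e]
      positivity
    linarith

/-- `log G(1/2) = (1/24) log 2 - (1/4) log π + (3/2) ζ'(-1)`, where `G`
is the Barnes double gamma function (so `log G(1/2) = log G(3/2) - log Γ(1/2)`) and
`ζ'(-1)` is the derivative of the Riemann zeta function at `-1`. -/
theorem logBarnesG_one_half :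
    ((logBarnesG1p (1 / 2) - Real.log (Real.Gamma (1 / 2)) : ℝ) : ℂ)
      = ((1 / 24) * Real.log 2 - (1 / 4) * Real.log π : ℝ)
        + (3 / 2 : ℂ) * deriv riemannZeta (-1) := by
  obtain ⟨D, hD, hsum⟩ := exists_hasSum_altDiff_mul_log
  have hreal : logBarnesG1p (1 / 2) - Real.log (Real.Gamma (1 / 2))
      = 1 / 24 * Real.log 2 - 1 / 4 * Real.log π
        + (-D - 32 / 3 * Real.log 2 + 3 * Real.log 3) / 16 := by
    rw [logBarnesG1p, (hasSum_barnes_half hsum).tsum_eq, Real.Gamma_one_half_eq,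
      Real.log_sqrt Real.pi_pos.le, Real.log_mul two_ne_zero Real.pi_ne_zero]
    ring
  rw [hreal]
  push_cast
  rw [hD]
  ring
end

section
/- The first generalized Stieltjes constant at 1/2 satisfies γ₁(1/2) = γ₁ − log²2 − 2γ log 2, where γ₁ = γ₁(1) is the first Stieltjes constant and γ is the Euler–Mascheroni constant. -/
open Real Complex Filter Topology HurwitzZeta

lemma hurwitzZeta_one_half_of_one_lt_re {s : ℂ} (hs : 1 < s.re) :
    hurwitzZeta ((1 / 2 : ℝ) : UnitAddCircle) s = (2 ^ s - 1) * riemannZeta s := by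
  have hhalf := hasSum_hurwitzZeta_of_one_lt_re (a := 1 / 2) (by norm_num) hs
  have hone := hasSum_hurwitzZeta_of_one_lt_re (a := 1) (by norm_num) hs
  rw [AddCircle.coe_period, hurwitzZeta_zero] at hone
  have h2 : (2 : ℂ) ^ s ≠ 0 := by simp [cpow_eq_zero_iff]
  have hscale (x : ℝ) (hx : 0 ≤ x) :
      (2 ^ s)⁻¹ * (1 / (x : ℂ) ^ s) = 1 / ((2 * x : ℝ) : ℂ) ^ s := by
    rw [ofReal_mul, mul_cpow_ofReal_nonneg zero_le_two hx, ofReal_ofNat]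
    field_simp
  have heven : HasSum (fun n : ℕ ↦ 1 / (((2 * n : ℕ) : ℂ) + (1 : ℝ)) ^ s)
      ((2 ^ s)⁻¹ * hurwitzZeta ((1 / 2 : ℝ) : UnitAddCircle) s) := by
    refine (hhalf.mul_left _).congr_fun fun n ↦ ?_
    have := hscale (n + 1 / 2) (by positivity)
    push_cast at this ⊢
    rw [this]
    ring_nf
  have hodd : HasSum (fun n : ℕ ↦ 1 / (((2 * n + 1 : ℕ) : ℂ) + (1 : ℝ)) ^ s)
      ((2 ^ s)⁻¹ * riemannZeta s) := by
    refine (hone.mul_left _).congr_fun fun n ↦ ?_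
    have := hscale (n + 1) (by positivity)
    push_cast at this ⊢
    rw [this]
    ring_nf
  have hsum := hone.unique (HasSum.even_add_odd heven hodd)
  field_simp at hsum
  linear_combination -hsum

/-- The duplication formula `ζ(s, 1/2) = (2 ^ s - 1) ζ(s)`. -/
theorem hurwitzZeta_one_half {s : ℂ} (hs : s ≠ 1) :
    hurwitzZeta ((1 / 2 : ℝ) : UnitAddCircle) s = (2 ^ s - 1) * riemannZeta s := by
  have hpow : Differentiable ℂ fun z : ℂ ↦ (2 : ℂ) ^ z - 1 := by fun_prop (disch := simp)
  have hl : AnalyticOnNhd ℂ (hurwitzZeta ((1 / 2 : ℝ) : UnitAddCircle)) {1}ᶜ :=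
    DifferentiableOn.analyticOnNhd
      (fun z hz ↦ (differentiableAt_hurwitzZeta _ hz).differentiableWithinAt)
      isOpen_compl_singleton
  have hr : AnalyticOnNhd ℂ (fun z ↦ (2 ^ z - 1) * riemannZeta z) {1}ᶜ :=
    DifferentiableOn.analyticOnNhd
      (fun z hz ↦ ((hpow z).mul (differentiableAt_riemannZeta hz)).differentiableWithinAt)
      isOpen_compl_singleton
  have hconn : IsPreconnected ({1}ᶜ : Set ℂ) :=
    (isConnected_compl_singleton_of_one_lt_rank (by simp) 1).isPreconnected
  refine hl.eqOn_of_preconnected_of_eventuallyEq hr hconn (z₀ := 2) (by simp) ?_ hs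
  filter_upwards [(isOpen_lt continuous_const continuous_re).mem_nhds
    (show (1 : ℝ) < (2 : ℂ).re by simp)] with z hz
  exact hurwitzZeta_one_half_of_one_lt_re hz

/-- `s ↦ (s - 1) ζ(s)`, extended to `s = 1` by the residue. -/
lemma update_sub_one_mul_riemannZeta :
    Function.update (fun s : ℂ ↦ (s - 1) * riemannZeta s) 1 1 = riemannZeta₁ := by
  ext s
  rcases eq_or_ne s 1 with rfl | hs
  · simp
  · have : s - 1 ≠ 0 := sub_ne_zero.mpr hs
    rw [Function.update_of_ne hs, riemannZeta_eq_inv_sub_mul hs]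
    field_simp

lemma update_sub_one_mul_hurwitzZeta_one_half :
    Function.update (fun s : ℂ ↦ (s - 1) * hurwitzZeta ((1 / 2 : ℝ) : UnitAddCircle) s) 1 1
      = fun s ↦ (2 ^ s - 1) * riemannZeta₁ s := by
  rw [← update_sub_one_mul_riemannZeta]
  ext s
  rcases eq_or_ne s 1 with rfl | hs
  · norm_num
  · simp only [Function.update_of_ne hs, hurwitzZeta_one_half hs]
    ring

lemma iteratedDeriv_two_two_cpow_sub_one_mul {f : ℂ → ℂ} (hf : Differentiable ℂ f) (s : ℂ) :
    iteratedDeriv 2 (fun z ↦ (2 ^ z - 1) * f z) s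
      = 2 ^ s * Complex.log 2 ^ 2 * f s + 2 * (2 ^ s * Complex.log 2) * deriv f s
        + (2 ^ s - 1) * iteratedDeriv 2 f s := by
  have hpow (z : ℂ) : HasDerivAt (fun z : ℂ ↦ (2 : ℂ) ^ z) (2 ^ z * Complex.log 2) z := by
    simpa using (hasDerivAt_id z).const_cpow (c := 2) (Or.inl two_ne_zero)
  have hderiv : deriv (fun z ↦ (2 ^ z - 1) * f z)
      = fun z ↦ 2 ^ z * Complex.log 2 * f z + (2 ^ z - 1) * deriv f z :=
    funext fun z ↦ (((hpow z).sub_const 1).mul (hf z).hasDerivAt).deriv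
  have hf' : HasDerivAt (deriv f) (deriv (deriv f) s) s :=
    (hf.contDiff.differentiable_deriv_two s).hasDerivAt
  simp only [iteratedDeriv_succ, iteratedDeriv_zero, hderiv]
  refine (((((hpow s).mul_const _).mul (hf s).hasDerivAt).add
    (((hpow s).sub_const 1).mul hf')).deriv).trans ?_
  ring

/-- `γ₁(1/2) = γ₁ - log²2 - 2γ log 2`, where `γ₁ = γ₁(1)`. -/
theorem stieltjes_gamma1_one_half :
    stieltjesGamma1 (1 / 2)
      = stieltjesGamma1 1 - ((Real.log 2) ^ 2 : ℝ)
        - ((2 * Real.eulerMascheroniConstant * Real.log 2 : ℝ) : ℂ) := by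
  have hlog : ((Real.log 2 : ℝ) : ℂ) = Complex.log 2 := by simp
  simp only [stieltjesGamma1]
  rw [update_sub_one_mul_hurwitzZeta_one_half, AddCircle.coe_period, hurwitzZeta_zero,
    update_sub_one_mul_riemannZeta,
    iteratedDeriv_two_two_cpow_sub_one_mul differentiable_riemannZeta₁, riemannZeta₁_one,
    deriv_riemannZeta₁_one, cpow_one, ← hlog]
  push_cast
  ring
end

section
/- The first generalized Stieltjes constant at 1/4 satisfies γ₁(1/4) = (1/2)[2γ₁ − 7 log²2 − 6γ log 2] − (π/2)[γ + 4 log 2 + 3 log π − 4 log Γ(1/4)], where γ₁ = γ₁(1) is the first Stieltjes constant, γ is the Euler–Mascheroni constant, and Γ is the Euler gamma function. -/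
open Real Complex Filter Topology HurwitzZeta

/-- The mean value estimate for `x ↦ x ^ w` on an interval of positive reals. -/
lemma norm_cpow_sub_cpow_le {c d C x y : ℝ} (hc : 0 < c) (w : ℂ)
    (hC : ∀ t ∈ Set.Icc c d, t ^ (w.re - 1) ≤ C) (hx : x ∈ Set.Icc c d) (hy : y ∈ Set.Icc c d) :
    ‖(y : ℂ) ^ w - (x : ℂ) ^ w‖ ≤ ‖w‖ * C * |y - x| := by
  refine (convex_Icc c d).norm_image_sub_le_of_norm_hasDerivWithin_le (𝕜 := ℝ)
    (f := fun t : ℝ => (t : ℂ) ^ w) (f' := fun t : ℝ => w * (t : ℂ) ^ (w - 1))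
    (fun t ht => ?_) (fun t ht => ?_) hx hy
  · have ht0 : 0 < t := hc.trans_le ht.1
    have := ((hasDerivAt_id (t : ℂ)).cpow_const (c := w) (by simp [slitPlane, ht0]))
    simpa using this.comp_ofReal.hasDerivWithinAt
  · rw [norm_mul, norm_cpow_eq_rpow_re_of_pos (hc.trans_le ht.1)]
    gcongr
    simpa using hC t ht

/-- The terms of the Dirichlet series of `2 * hurwitzZetaOdd a s - (1 - 2 * a) * s * ζ(s + 1)`. -/
noncomputable def hurwitzOddTerm (a : ℝ) (n : ℕ) (s : ℂ) : ℂ :=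
  ((n + a : ℝ) : ℂ) ^ (-s) - ((n + 1 - a : ℝ) : ℂ) ^ (-s)
    - (1 - 2 * a) * s * ((n + 1 : ℝ) : ℂ) ^ (-s - 1)

lemma norm_hurwitzOddTerm_le {a δ : ℝ} (hδ : 0 < δ) (hδa : δ ≤ a) (hδa' : δ ≤ 1 - a) (n : ℕ)
    {s : ℂ} (hs : -(1 / 2) < s.re) (hs' : ‖s‖ < 3) :
    ‖hurwitzOddTerm a n s‖ ≤ 12 * δ ^ (-5 : ℝ) * ((n + 1 : ℝ)) ^ (-(3 / 2) : ℝ) := by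
  set m : ℝ := n + 1 with hm
  have hm1 : 1 ≤ m := by simp [hm]
  have hn : (0 : ℝ) ≤ n := n.cast_nonneg
  have hres : s.re < 3 := ((le_abs_self _).trans (abs_re_le_norm s)).trans_lt hs'
  have hδ1 : δ ≤ 1 := by linarith
  have hc : 0 < n + δ := by positivity
  set B : ℝ := δ ^ (-5 : ℝ) * m ^ (-(3 / 2) : ℝ) with hB
  have hB0 : 0 ≤ B := by positivity
  have key : ∀ t ∈ Set.Icc (n + δ) m, t ^ (-s.re - 2) ≤ B := by
    intro t ht
    have h1 : m * δ ≤ t := by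
      have : m * δ ≤ n + δ := by rw [hm]; nlinarith
      exact this.trans ht.1
    calc t ^ (-s.re - 2) ≤ (m * δ) ^ (-s.re - 2) :=
          Real.rpow_le_rpow_of_nonpos (by positivity) h1 (by linarith)
      _ = δ ^ (-s.re - 2) * m ^ (-s.re - 2) := by
          rw [Real.mul_rpow (by positivity) hδ.le, mul_comm]
      _ ≤ δ ^ (-5 : ℝ) * m ^ (-(3 / 2) : ℝ) := by
          gcongr ?_ * ?_
          · exact Real.rpow_le_rpow_of_exponent_ge hδ hδ1 (by linarith)
          · exact Real.rpow_le_rpow_of_exponent_le hm1 (by linarith)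
  have hmem : ∀ t ∈ Set.Icc (n + δ) m, 0 < t := fun t ht => hc.trans_le ht.1
  have step : ∀ t ∈ Set.Icc (n + δ) m, ‖(t : ℂ) ^ (-s - 1) - (m : ℂ) ^ (-s - 1)‖ ≤ 4 * B := by
    intro t ht
    have h := norm_cpow_sub_cpow_le (C := B) hc (-s - 1)
      (fun t ht => by
        have := key t ht
        convert this using 2
        simp; ring) (x := m) (y := t) ⟨by linarith, le_rfl⟩ ht
    have h4 : ‖-s - 1‖ ≤ 4 := by
      refine (norm_sub_le _ _).trans ?_
      simp; linarith
    have h5 : |t - m| ≤ 1 := by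
      rw [abs_le]; constructor <;> [linarith [ht.1]; linarith [ht.2]]
    calc _ ≤ _ := h
      _ ≤ 4 * B * 1 := by gcongr
      _ = _ := by ring
  have h := (convex_Icc (n + δ) m).norm_image_sub_le_of_norm_hasDerivWithin_le (𝕜 := ℝ)
    (f := fun t : ℝ => (t : ℂ) ^ (-s) + s * (m : ℂ) ^ (-s - 1) * t)
    (f' := fun t : ℝ => -s * ((t : ℂ) ^ (-s - 1) - (m : ℂ) ^ (-s - 1))) (C := 3 * (4 * B))
    (x := n + 1 - a) (y := n + a)
    (fun t ht => by
      have h1 := ((hasDerivAt_id (t : ℂ)).cpow_const (c := -s)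
        (by simp [slitPlane, hmem t ht])).comp_ofReal
      have h2 := ((hasDerivAt_id (t : ℂ)).const_mul (s * (m : ℂ) ^ (-s - 1))).comp_ofReal
      refine (h1.add h2).hasDerivWithinAt.congr_deriv ?_
      simp only [id_eq]
      ring)
    (fun t ht => by
      rw [norm_mul, norm_neg]
      gcongr
      exact step t ht)
    ⟨by linarith, by linarith⟩ ⟨by linarith, by linarith⟩
  have h5 : ‖(n + a : ℝ) - (n + 1 - a)‖ ≤ 1 := by
    rw [Real.norm_eq_abs, abs_le]; constructor <;> linarith
  calc ‖hurwitzOddTerm a n s‖ = _ := by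
        congr 1
        have hmC : (m : ℂ) = n + 1 := by simp [hm]
        rw [hurwitzOddTerm, ← hm]
        push_cast
        linear_combination s * (m : ℂ) ^ (-s - 1) * hmC
    _ ≤ _ := h
    _ ≤ 3 * (4 * B) * 1 := by gcongr
    _ = _ := by rw [hB]; ring

lemma summable_nat_add_one_rpow : Summable fun n : ℕ => ((n + 1 : ℝ)) ^ (-(3 / 2) : ℝ) := by
  have := (summable_nat_add_iff 1).mpr (Real.summable_nat_rpow (p := -(3 / 2)).mpr (by norm_num))
  simpa using this

lemma differentiable_hurwitzOddTerm {a : ℝ} (ha : a ∈ Set.Ioo 0 1) (n : ℕ) :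
    Differentiable ℂ (hurwitzOddTerm a n) := by
  have h1 : ((n + a : ℝ) : ℂ) ≠ 0 := by
    have := ha.1; exact_mod_cast (by positivity : (n + a : ℝ) ≠ 0)
  have h2 : ((n + 1 - a : ℝ) : ℂ) ≠ 0 := by
    have := ha.2
    have hn : (0 : ℝ) ≤ n := n.cast_nonneg
    exact_mod_cast (by linarith : (0 : ℝ) < n + 1 - a).ne'
  have h3 : ((n + 1 : ℝ) : ℂ) ≠ 0 := by exact_mod_cast (by positivity : (n + 1 : ℝ) ≠ 0)
  unfold hurwitzOddTerm
  intro s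
  have e1 := (differentiableAt_id (x := s)).neg.const_cpow (Or.inl h1)
  have e2 := (differentiableAt_id (x := s)).neg.const_cpow (Or.inl h2)
  have e3 := ((differentiableAt_id (x := s)).neg.sub_const 1).const_cpow (Or.inl h3)
  exact (e1.sub e2).sub ((differentiableAt_id.const_mul _).mul e3)

lemma deriv_hurwitzOddTerm_zero {a : ℝ} (ha : a ∈ Set.Ioo 0 1) (n : ℕ) :
    deriv (hurwitzOddTerm a n) 0
      = ((Real.log (n + 1 - a) - Real.log (n + a) - (1 - 2 * a) * (n + 1 : ℝ)⁻¹ : ℝ) : ℂ) := by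
  have hn : (0 : ℝ) ≤ n := n.cast_nonneg
  have h1 : 0 < (n + a : ℝ) := by linarith [ha.1]
  have h2 : 0 < (n + 1 - a : ℝ) := by linarith [ha.2]
  have h3 : 0 < (n + 1 : ℝ) := by linarith
  have e1 := (hasDerivAt_id (0 : ℂ)).neg.const_cpow (c := ((n + a : ℝ) : ℂ))
    (Or.inl (ofReal_ne_zero.mpr h1.ne'))
  have e2 := (hasDerivAt_id (0 : ℂ)).neg.const_cpow (c := ((n + 1 - a : ℝ) : ℂ))
    (Or.inl (ofReal_ne_zero.mpr h2.ne'))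
  have e3 := ((hasDerivAt_id (0 : ℂ)).neg.sub_const 1).const_cpow (c := ((n + 1 : ℝ) : ℂ))
    (Or.inl (ofReal_ne_zero.mpr h3.ne'))
  have := ((e1.sub e2).sub (((hasDerivAt_id (0 : ℂ)).const_mul (1 - 2 * a : ℂ)).mul e3)).deriv
  refine Eq.trans this ?_
  rw [← ofReal_log h1.le, ← ofReal_log h2.le]
  simp [cpow_neg_one]
  ring

/-- The half-disc on which the series of `hurwitzOddTerm a` is bounded uniformly. -/
def hurwitzOddDomain : Set ℂ := {s | -(1 / 2) < s.re} ∩ Metric.ball 0 3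

lemma isOpen_hurwitzOddDomain : IsOpen hurwitzOddDomain :=
  (isOpen_lt continuous_const continuous_re).inter Metric.isOpen_ball

lemma convex_hurwitzOddDomain : Convex ℝ hurwitzOddDomain :=
  (convex_halfSpace_re_gt _).inter (convex_ball _ _)

lemma zero_mem_hurwitzOddDomain : (0 : ℂ) ∈ hurwitzOddDomain := by
  constructor <;> simp

lemma exists_summable_norm_hurwitzOddTerm_le {a : ℝ} (ha : a ∈ Set.Ioo 0 1) :
    ∃ u : ℕ → ℝ, Summable u ∧ ∀ n, ∀ s ∈ hurwitzOddDomain, ‖hurwitzOddTerm a n s‖ ≤ u n := by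
  have hδ : 0 < min a (1 - a) := lt_min ha.1 (by linarith [ha.2])
  exact ⟨_, summable_nat_add_one_rpow.mul_left (12 * min a (1 - a) ^ (-5 : ℝ)), fun n s hs =>
    norm_hurwitzOddTerm_le hδ (min_le_left _ _) (min_le_right _ _) n hs.1 (by simpa using hs.2)⟩

/-- The analytic continuation of `hurwitzZetaOdd` to a neighbourhood of `0` as a series. -/
lemma eqOn_two_mul_hurwitzZetaOdd {a : ℝ} (ha : a ∈ Set.Ioo 0 1) :
    Set.EqOn (fun s => 2 * hurwitzZetaOdd a s)
      (fun s => ∑' n, hurwitzOddTerm a n s + (1 - 2 * a) * riemannZeta₁ (s + 1))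
      hurwitzOddDomain := by
  obtain ⟨u, hu, hle⟩ := exists_summable_norm_hurwitzOddTerm_le ha
  have hf : Differentiable ℂ fun s => 2 * hurwitzZetaOdd a s :=
    (differentiable_hurwitzZetaOdd a).const_mul 2
  have hg1 : DifferentiableOn ℂ (fun s => ∑' n, hurwitzOddTerm a n s) hurwitzOddDomain :=
    Complex.differentiableOn_tsum_of_summable_norm hu
      (fun n => (differentiable_hurwitzOddTerm ha n).differentiableOn) isOpen_hurwitzOddDomain hle
  have hg2 : Differentiable ℂ fun s : ℂ => (1 - 2 * a : ℂ) * riemannZeta₁ (s + 1) := by fun_prop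
  have h2 : (2 : ℂ) ∈ hurwitzOddDomain := by constructor <;> norm_num
  have hfa := hf.differentiableOn.analyticOnNhd isOpen_hurwitzOddDomain
  refine hfa.eqOn_of_preconnected_of_eventuallyEq
    ((hg1.add hg2.differentiableOn).analyticOnNhd isOpen_hurwitzOddDomain)
    convex_hurwitzOddDomain.isPreconnected h2 ?_
  have hev : ∀ᶠ s : ℂ in 𝓝 2, 1 < s.re :=
    continuous_re.continuousAt.eventually (lt_mem_nhds (by norm_num))
  filter_upwards [hev] with s hs
  have hs1 : 1 < (s + 1).re := by simp; linarith
  have hs0 : s + 1 ≠ 1 := fun h => by simp [h] at hs1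
  have e1 := (hasSum_nat_hurwitzZetaOdd_of_mem_Icc ⟨ha.1.le, ha.2.le⟩ hs).mul_left 2
  have e2 : HasSum (fun n : ℕ => 1 / ((n : ℂ) + 1) ^ (s + 1)) (riemannZeta (s + 1)) := by
    rw [zeta_eq_tsum_one_div_nat_add_one_cpow hs1]
    have := (summable_nat_add_iff 1).mpr (Complex.summable_one_div_nat_cpow.mpr hs1)
    exact (by simpa using this : Summable fun n : ℕ => 1 / ((n : ℂ) + 1) ^ (s + 1)).hasSum
  have e3 := e1.sub (e2.mul_left ((1 - 2 * a) * s))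
  have e4 : HasSum (fun n => hurwitzOddTerm a n s)
      (2 * hurwitzZetaOdd a s - (1 - 2 * a) * s * riemannZeta (s + 1)) := by
    refine e3.congr_fun fun n => ?_
    rw [hurwitzOddTerm, show -s - 1 = -(s + 1) by ring]
    simp only [cpow_neg]
    push_cast
    ring
  rw [e4.tsum_eq, riemannZeta_eq_inv_sub_mul hs0]
  have : s ≠ 0 := by simpa using hs0
  simp only [add_sub_cancel_right]
  field_simp
  ring

lemma hurwitzZetaOdd_apply_zero {a : ℝ} (ha : a ∈ Set.Ioo 0 1) :
    hurwitzZetaOdd a 0 = (1 - 2 * a) / 2 := by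
  have h := eqOn_two_mul_hurwitzZetaOdd ha zero_mem_hurwitzOddDomain
  simp [hurwitzOddTerm] at h
  linear_combination h / 2

lemma tendsto_sum_log_sub_log {a : ℝ} (ha : a ∈ Set.Ioo 0 1) :
    Tendsto (fun N : ℕ => ∑ n ∈ Finset.range (N + 1),
      (Real.log (n + 1 - a) - Real.log (n + a) - (1 - 2 * a) * (n + 1 : ℝ)⁻¹)) atTop
      (𝓝 (Real.log (Real.Gamma a) - Real.log (Real.Gamma (1 - a))
        - (1 - 2 * a) * eulerMascheroniConstant)) := by
  have h1 := Real.BohrMollerup.tendsto_log_gamma ha.1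
  have h2 := Real.BohrMollerup.tendsto_log_gamma (sub_pos.mpr ha.2)
  have h3 := (Real.tendsto_harmonic_sub_log.comp (tendsto_add_atTop_nat 1)).add
    Real.tendsto_log_nat_add_one_sub_log
  rw [add_zero] at h3
  refine ((h1.sub h2).sub (h3.const_mul (1 - 2 * a))).congr fun N => ?_
  simp only [Real.BohrMollerup.logGammaSeq, Function.comp_apply, harmonic, Finset.sum_sub_distrib,
    ← Finset.mul_sum]
  push_cast
  have e1 : ∀ n : ℕ, Real.log (1 - a + n) = Real.log (n + 1 - a) := fun n => by congr 1; ring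
  have e2 : ∀ n : ℕ, Real.log (a + n) = Real.log (n + a) := fun n => by congr 1; ring
  simp only [e1, e2]
  ring

/-- The odd part of Lerch's formula for the derivative of the Hurwitz zeta function at `0`. -/
lemma hasDerivAt_hurwitzZetaOdd_zero {a : ℝ} (ha : a ∈ Set.Ioo 0 1) :
    HasDerivAt (hurwitzZetaOdd a)
      (((Real.log (Real.Gamma a) - Real.log (Real.Gamma (1 - a))) / 2 : ℝ) : ℂ) 0 := by
  obtain ⟨u, hu, hle⟩ := exists_summable_norm_hurwitzOddTerm_le ha
  have hd : ∀ n, DifferentiableOn ℂ (hurwitzOddTerm a n) hurwitzOddDomain := fun n =>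
    (differentiable_hurwitzOddTerm ha n).differentiableOn
  have hsum := Complex.hasSum_deriv_of_summable_norm hu hd isOpen_hurwitzOddDomain hle
    zero_mem_hurwitzOddDomain
  have hdiff := ((Complex.differentiableOn_tsum_of_summable_norm hu hd isOpen_hurwitzOddDomain
    hle).differentiableAt (isOpen_hurwitzOddDomain.mem_nhds zero_mem_hurwitzOddDomain)).hasDerivAt
  have hval := tendsto_nhds_unique (hsum.tendsto_sum_nat.comp (tendsto_add_atTop_nat 1))
    (((continuous_ofReal.tendsto _).comp (tendsto_sum_log_sub_log ha)).congr fun N => by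
      simp only [Function.comp_apply, ofReal_sum, deriv_hurwitzOddTerm_zero ha])
  rw [hval] at hdiff
  have hz : HasDerivAt (fun s : ℂ => riemannZeta₁ (s + 1)) eulerMascheroniConstant 0 := by
    refine HasDerivAt.comp_add_const 0 1 ?_
    rw [zero_add, ← deriv_riemannZeta₁_one]
    exact differentiable_riemannZeta₁.differentiableAt.hasDerivAt
  have h := ((hdiff.add (hz.const_mul (1 - 2 * a : ℂ))).congr_of_eventuallyEq
    ((eqOn_two_mul_hurwitzZetaOdd ha).eventuallyEq_of_mem
      (isOpen_hurwitzOddDomain.mem_nhds zero_mem_hurwitzOddDomain))).const_mul (1 / 2)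
  refine (h.congr_deriv ?_).congr_of_eventuallyEq (.of_eq (funext fun s => ?_))
  · push_cast; ring
  · ring

lemma ZMod.sum_four {M : Type*} [AddCommMonoid M] (f : ZMod 4 → M) :
    ∑ j, f j = f 0 + f 1 + f 2 + f (-1) :=
  Fin.sum_univ_four f

lemma toAddCircle_one_four : ZMod.toAddCircle (1 : ZMod 4) = ((1 / 4 : ℝ) : UnitAddCircle) := by
  simpa using ZMod.toAddCircle_intCast (N := 4) 1

lemma hurwitzZeta_neg (a : UnitAddCircle) (s : ℂ) :
    hurwitzZeta (-a) s = hurwitzZetaEven a s - hurwitzZetaOdd a s := by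
  rw [hurwitzZeta, hurwitzZetaEven_neg, hurwitzZetaOdd_neg, sub_eq_add_neg]

lemma two_mul_hurwitzZetaEven_one_quarter {s : ℂ} (hs : s ≠ 1) :
    2 * hurwitzZetaEven ((1 / 4 : ℝ) : UnitAddCircle) s = (4 ^ s - 2 ^ s) * riemannZeta s := by
  have h := DirichletCharacter.LFunctionTrivChar_eq_mul_riemannZeta (N := 4) hs
  have hp : Nat.primeFactors 4 = {2} := by
    rw [show 4 = 2 ^ 2 by norm_num, Nat.primeFactors_prime_pow two_ne_zero Nat.prime_two]
  have h0 : (1 : DirichletCharacter ℂ 4) 0 = 0 := MulChar.map_nonunit _ (by decide)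
  have h2 : (1 : DirichletCharacter ℂ 4) 2 = 0 := MulChar.map_nonunit _ (by decide)
  have h3 : (1 : DirichletCharacter ℂ 4) (-1) = 1 := MulChar.one_apply (by decide)
  rw [hp, Finset.prod_singleton, DirichletCharacter.LFunctionTrivChar,
    DirichletCharacter.LFunction, ZMod.LFunction, ZMod.sum_four, h0, h2, h3, map_one, map_neg,
    toAddCircle_one_four, hurwitzZeta_neg, hurwitzZeta] at h
  have h4 : (4 : ℂ) ^ s = 2 ^ s * 2 ^ s := by
    rw [show (4 : ℂ) = ((2 : ℝ) : ℂ) * ((2 : ℝ) : ℂ) by norm_num,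
      mul_cpow_ofReal_nonneg (by norm_num) (by norm_num)]
    simp
  have hne : (2 : ℂ) ^ s ≠ 0 := by simp [cpow_eq_zero_iff]
  simp only [Nat.cast_ofNat, cpow_neg, h4] at h ⊢
  simp only [hurwitzZeta] at h
  field_simp at h
  linear_combination h

lemma sinZeta_one_quarter (s : ℂ) :
    sinZeta ((1 / 4 : ℝ) : UnitAddCircle) s
      = 2 * 4 ^ (-s) * hurwitzZetaOdd ((1 / 4 : ℝ) : UnitAddCircle) s := by
  have hc (j : ℤ) : ZMod.stdAddChar (N := 4) (j : ZMod 4) = I ^ j := by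
    conv_rhs => rw [← exp_pi_div_two_mul_I, ← Complex.exp_int_mul]
    rw [ZMod.stdAddChar_coe]
    congr 1; push_cast; ring
  have c0 : ZMod.stdAddChar (N := 4) 0 = 1 := by simp
  have c1 : ZMod.stdAddChar (N := 4) 1 = I := by simpa using hc 1
  have c2 : ZMod.stdAddChar (N := 4) 2 = -1 := by simpa using hc 2
  have c3 : ZMod.stdAddChar (N := 4) (-1) = -I := by simpa using hc (-1)
  have h1 := ZMod.LFunction_stdAddChar_eq_expZeta (1 : ZMod 4) s (Or.inl (by decide))
  have h2 := ZMod.LFunction_stdAddChar_eq_expZeta (-1 : ZMod 4) s (Or.inl (by decide))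
  have e2 : (-1 : ZMod 4) * 2 = 2 := by decide
  rw [ZMod.LFunction, ZMod.sum_four] at h1 h2
  simp only [mul_zero, mul_one, one_mul, e2, neg_mul, neg_neg, c0, c1, c2, c3, map_neg, map_zero,
    toAddCircle_one_four, hurwitzZeta_neg, Nat.cast_ofNat] at h1 h2
  rw [sinZeta_eq, ← h1, ← h2]
  simp only [hurwitzZeta]
  field

lemma one_quarter_mem_Ioo : (1 / 4 : ℝ) ∈ Set.Ioo 0 1 := by constructor <;> norm_num

lemma hurwitzZetaOdd_one_quarter_one_sub {s : ℂ} (hs : ∀ n : ℕ, s ≠ -n) :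
    hurwitzZetaOdd ((1 / 4 : ℝ) : UnitAddCircle) (1 - s)
      = 4 * (((8 * π : ℝ) : ℂ) ^ (-s) * Complex.Gamma s * Complex.sin (π * s / 2)
          * hurwitzZetaOdd ((1 / 4 : ℝ) : UnitAddCircle) s) := by
  rw [hurwitzZetaOdd_one_sub _ hs, sinZeta_one_quarter,
    show (8 * π : ℝ) = (2 * π) * 4 by ring, ofReal_mul,
    mul_cpow_ofReal_nonneg (by positivity) (by norm_num)]
  push_cast
  ring

lemma one_ne_neg_natCast (n : ℕ) : (1 : ℂ) ≠ -n := by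
  rw [ne_eq, eq_neg_iff_add_eq_zero]
  exact_mod_cast (by omega : 1 + n ≠ 0)

lemma hurwitzZetaOdd_one_quarter_one :
    hurwitzZetaOdd ((1 / 4 : ℝ) : UnitAddCircle) 1 = π / 2 := by
  have h := hurwitzZetaOdd_one_quarter_one_sub one_ne_neg_natCast
  rw [sub_self, hurwitzZetaOdd_apply_zero one_quarter_mem_Ioo, Complex.Gamma_one, mul_one, mul_one,
    Complex.sin_pi_div_two, cpow_neg_one] at h
  have hπ : (π : ℂ) ≠ 0 := ofReal_ne_zero.mpr pi_ne_zero
  push_cast at h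
  field_simp at h
  linear_combination -h / 32

lemma log_Gamma_three_quarters :
    Real.log (Real.Gamma (1 - 1 / 4))
      = Real.log π + Real.log 2 / 2 - Real.log (Real.Gamma (1 / 4)) := by
  have h := Real.Gamma_mul_Gamma_one_sub (1 / 4)
  have h1 : 0 < Real.Gamma (1 / 4) := Real.Gamma_pos_of_pos (by norm_num)
  have h2 : 0 < Real.Gamma (1 - 1 / 4) := Real.Gamma_pos_of_pos (by norm_num)
  have h3 := congrArg Real.log h
  rw [Real.log_mul h1.ne' h2.ne', mul_one_div, Real.sin_pi_div_four, Real.log_div pi_ne_zero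
    (by positivity), Real.log_div (by positivity) (by positivity),
    Real.log_sqrt (by norm_num)] at h3
  linarith

lemma deriv_hurwitzZetaOdd_one_quarter_one :
    deriv (hurwitzZetaOdd ((1 / 4 : ℝ) : UnitAddCircle)) 1
      = (((π / 2) * (Real.eulerMascheroniConstant + 4 * Real.log 2 + 3 * Real.log π
            - 4 * Real.log (Real.Gamma (1 / 4))) : ℝ) : ℂ) := by
  have hπ : (π : ℂ) ≠ 0 := ofReal_ne_zero.mpr pi_ne_zero
  have h8 : ((8 * π : ℝ) : ℂ) ≠ 0 := ofReal_ne_zero.mpr (by positivity)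
  have hO := (differentiable_hurwitzZetaOdd ((1 / 4 : ℝ) : UnitAddCircle) 1).hasDerivAt
  have hl : HasDerivAt (fun s : ℂ => hurwitzZetaOdd ((1 / 4 : ℝ) : UnitAddCircle) (1 - s)) _ 1 :=
    HasDerivAt.comp_const_sub 1 1
      ((sub_self (1 : ℂ)).symm ▸ hasDerivAt_hurwitzZetaOdd_zero one_quarter_mem_Ioo)
  have hp := (hasDerivAt_id (1 : ℂ)).neg.const_cpow (c := ((8 * π : ℝ) : ℂ)) (Or.inl h8)
  have hs := (((hasDerivAt_id (1 : ℂ)).const_mul (π : ℂ)).div_const 2).csin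
  have hr := ((((hp.mul Complex.hasDerivAt_Gamma_one).mul hs).mul hO)).const_mul 4
  have hev : ∀ᶠ s : ℂ in 𝓝 1, ∀ n : ℕ, s ≠ -n := by
    filter_upwards [continuous_re.continuousAt.eventually
      (lt_mem_nhds (by simp : (0 : ℝ) < (1 : ℂ).re))] with s hs n hn
    have : (n : ℝ) ≥ 0 := n.cast_nonneg
    simp [hn] at hs
    linarith
  have h := hl.unique (hr.congr_of_eventuallyEq
    (hev.mono fun s hs => hurwitzZetaOdd_one_quarter_one_sub hs))
  have hlog : Real.log (8 * π) = 3 * Real.log 2 + Real.log π := by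
    rw [Real.log_mul (by norm_num) pi_ne_zero, show (8 : ℝ) = 2 ^ 3 by norm_num, Real.log_pow]
    norm_num
  simp only [id_eq, Pi.mul_apply, Pi.neg_apply, mul_one, Complex.sin_pi_div_two,
    Complex.cos_pi_div_two, Complex.Gamma_one, cpow_neg_one, hurwitzZetaOdd_one_quarter_one,
    ← ofReal_log (by positivity : 0 ≤ 8 * π), hlog, log_Gamma_three_quarters] at h
  push_cast at h ⊢
  field_simp at h
  linear_combination -h / 16

lemma update_sub_one_mul_hurwitzZeta_one_quarter :
    Function.update (fun s : ℂ => (s - 1) * hurwitzZeta ((1 / 4 : ℝ) : UnitAddCircle) s) 1 1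
      = fun s => (4 ^ s - 2 ^ s) / 2 * riemannZeta₁ s
          + (s - 1) * hurwitzZetaOdd ((1 / 4 : ℝ) : UnitAddCircle) s := by
  ext s
  rcases eq_or_ne s 1 with rfl | hs
  · norm_num
  · have h := two_mul_hurwitzZetaEven_one_quarter hs
    rw [riemannZeta_eq_inv_sub_mul hs] at h
    have : s - 1 ≠ 0 := sub_ne_zero.mpr hs
    rw [Function.update_of_ne hs, hurwitzZeta]
    field_simp at h
    linear_combination h / 2

lemma update_sub_one_mul_hurwitzZeta_one :
    Function.update (fun s : ℂ => (s - 1) * hurwitzZeta ((1 : ℝ) : UnitAddCircle) s) 1 1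
      = riemannZeta₁ := by
  ext s
  rcases eq_or_ne s 1 with rfl | hs
  · simp
  · have : s - 1 ≠ 0 := sub_ne_zero.mpr hs
    rw [Function.update_of_ne hs, show ((1 : ℝ) : UnitAddCircle) = 0 from AddCircle.coe_period 1,
      hurwitzZeta_zero, riemannZeta_eq_inv_sub_mul hs]
    field_simp

/-- The second derivative at `1` of `(4 ^ s - 2 ^ s) / 2 * f s + (s - 1) * g s`. -/
lemma iteratedDeriv_two_quarter_combination {f g : ℂ → ℂ} (hf : Differentiable ℂ f)
    (hg : Differentiable ℂ g) :
    iteratedDeriv 2 (fun s => (4 ^ s - 2 ^ s) / 2 * f s + (s - 1) * g s) 1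
      = 7 * Complex.log 2 ^ 2 * f 1 + 6 * Complex.log 2 * deriv f 1 + iteratedDeriv 2 f 1
          + 2 * deriv g 1 := by
  have h4 : Complex.log 4 = 2 * Complex.log 2 := by
    rw [show (4 : ℂ) = ((4 : ℝ) : ℂ) by norm_num, show (2 : ℂ) = ((2 : ℝ) : ℂ) by norm_num,
      ← ofReal_log (by norm_num), ← ofReal_log (by norm_num),
      show (4 : ℝ) = 2 ^ 2 by norm_num, Real.log_pow]
    norm_num
  have hpow (c : ℂ) (hc : c ≠ 0) (s : ℂ) :
      HasDerivAt (fun s => c ^ s) (c ^ s * Complex.log c) s := by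
    simpa using (hasDerivAt_id s).const_cpow (c := c) (Or.inl hc)
  have h1 : deriv (fun s => (4 ^ s - 2 ^ s) / 2 * f s + (s - 1) * g s) = fun s : ℂ =>
      (4 ^ s * Complex.log 4 - 2 ^ s * Complex.log 2) / 2 * f s + (4 ^ s - 2 ^ s) / 2 * deriv f s
        + (1 * g s + (s - 1) * deriv g s) := by
    ext s
    exact (((((hpow 4 (by norm_num) s).sub (hpow 2 (by norm_num) s)).div_const 2).mul
      (hf s).hasDerivAt).add (((hasDerivAt_id s).sub_const 1).mul (hg s).hasDerivAt)).deriv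
  have h2 := ((((((hpow 4 (by norm_num) 1).mul_const (Complex.log 4)).sub
    ((hpow 2 (by norm_num) 1).mul_const (Complex.log 2))).div_const 2).mul
      (hf 1).hasDerivAt).add ((((hpow 4 (by norm_num) 1).sub (hpow 2 (by norm_num) 1)).div_const
        2).mul (hf.deriv 1).hasDerivAt)).add (((hg 1).hasDerivAt.const_mul 1).add
          (((hasDerivAt_id (1 : ℂ)).sub_const 1).mul (hg.deriv 1).hasDerivAt))
  rw [iteratedDeriv_succ, iteratedDeriv_one, h1, iteratedDeriv_succ, iteratedDeriv_one]
  refine h2.deriv.trans ?_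
  simp only [id_eq, cpow_one, h4, Pi.sub_apply]
  ring

/-- `γ₁(1/4) = (1/2)[2γ₁ - 7 log²2 - 6γ log 2] - (π/2)[γ + 4 log 2 + 3 log π - 4 log Γ(1/4)]`,
where `γ₁ = γ₁(1)` is the first Stieltjes constant. -/
theorem stieltjes_gamma1_one_quarter :
    stieltjesGamma1 (1 / 4)
      = (1 / 2 : ℂ) * (2 * stieltjesGamma1 1
          - ((7 * Real.log 2 ^ 2 + 6 * Real.eulerMascheroniConstant * Real.log 2 : ℝ) : ℂ))
        - ((π / 2) * (Real.eulerMascheroniConstant + 4 * Real.log 2 + 3 * Real.log π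
            - 4 * Real.log (Real.Gamma (1 / 4))) : ℝ) := by
  rw [stieltjesGamma1, stieltjesGamma1, update_sub_one_mul_hurwitzZeta_one_quarter,
    update_sub_one_mul_hurwitzZeta_one, iteratedDeriv_two_quarter_combination
      differentiable_riemannZeta₁ (differentiable_hurwitzZetaOdd _),
    ← deriv_hurwitzZetaOdd_one_quarter_one, riemannZeta₁_one, deriv_riemannZeta₁_one]
  have h2 : Complex.log 2 = Real.log 2 := by
    simp
  rw [h2]
  push_cast
  ring
end
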